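/- arXiv:1906.11965 — 5 statements merged into one kernel-verified Lean document; each statement's English description precedes it below -/
import Mathlib

section
/- For any tetrahedron, the intrinsic diameter is bounded below by the extrinsic diameter and above by 2/√3 times the extrinsic diameter: diam(T) ≤ Diam(T) ≤ (2/√3) · diam(T). -/
open scoped ENNReal

/-- The intrinsic (geodesic) distance on a subset `T` of `ℝ³`: the infimum of the lengths of
continuous paths from `x` to `y` staying in `T`. -/
noncomputable def rho (T : Set (EuclideanSpace ℝ (Fin 3)))
    (x y : EuclideanSpace ℝ (Fin 3)) : ℝ≥0∞ :=
  ⨅ (γ : ℝ → EuclideanSpace ℝ (Fin 3)) (_ : Continuous γ) (_ : γ 0 = x) (_ : γ 1 = y)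
    (_ : ∀ t ∈ Set.Icc (0 : ℝ) 1, γ t ∈ T), eVariationOn γ (Set.Icc 0 1)

/-- Intrinsic diameter. -/
noncomputable def intrinsicDiam (T : Set (EuclideanSpace ℝ (Fin 3))) : ℝ≥0∞ :=
  ⨆ x ∈ T, ⨆ y ∈ T, rho T x y

/-- A ray leaving the nonnegative orthant does so through one of the decreasing coordinates. -/
theorem exists_exit_nonneg_orthant {ι : Type*} [Fintype ι] {z w : ι → ℝ} (hz : ∀ j, 0 ≤ z j)
    (hw : ∃ j, w j < 0) :
    ∃ t : ℝ, 0 ≤ t ∧ (∀ j, 0 ≤ z j + t * w j) ∧ ∃ j, w j < 0 ∧ z j + t * w j = 0 := by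
  classical
  obtain ⟨j₀, hj₀⟩ := hw
  obtain ⟨i, hi, hmin⟩ := Finset.exists_min_image (Finset.univ.filter fun j => w j < 0)
    (fun j => z j / (-w j)) ⟨j₀, by simpa using hj₀⟩
  have hi' : w i < 0 := by simpa using hi
  have ht : 0 ≤ z i / (-w i) := div_nonneg (hz i) (by linarith)
  refine ⟨z i / (-w i), ht, fun j => ?_, i, hi', ?_⟩
  · rcases lt_or_ge (w j) 0 with hj | hj
    · have h := hmin j (by simpa using hj)
      rw [le_div_iff₀ (by linarith)] at h
      linarith
    · have := mul_nonneg ht hj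
      linarith [hz j]
  · have : w i ≠ 0 := hi'.ne
    field_simp
    ring

/-- A linear map between finite-dimensional spaces whose domain is at least as large as its
codomain attains either `0` or any prescribed nonzero value at a nonzero vector. -/
theorem exists_ne_zero_map_eq_zero_or_eq {V W : Type*} [AddCommGroup V] [Module ℝ V]
    [FiniteDimensional ℝ V] [AddCommGroup W] [Module ℝ W] [FiniteDimensional ℝ W]
    (M : V →ₗ[ℝ] W) (h : Module.finrank ℝ W ≤ Module.finrank ℝ V) {c : W} (hc : c ≠ 0) :
    ∃ v, v ≠ 0 ∧ (M v = 0 ∨ M v = c) := by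
  by_cases hM : Function.Injective M
  · have h' := le_antisymm h (LinearMap.finrank_le_finrank_of_injective hM)
    obtain ⟨v, hv⟩ := (LinearMap.injective_iff_surjective_of_finrank_eq_finrank h'.symm).1 hM c
    refine ⟨v, ?_, Or.inr hv⟩
    rintro rfl
    exact hc (by rw [← hv, map_zero])
  · rw [injective_iff_map_eq_zero] at hM
    push Not at hM
    obtain ⟨v, hv, hv0⟩ := hM
    exact ⟨v, hv0, Or.inl hv⟩

/-- If a point of a polytope is covered by none of `k ≥ 1` closed convex sets, then neither is some
point with few nonzero coordinates, i.e. some point in a face of dimension less than `k`. -/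
theorem exists_small_support_notMem {ι V : Type*} [Fintype ι] [NormedAddCommGroup V]
    [NormedSpace ℝ V] {m k : ℕ} (hk : 0 < k) (Φ : (ι → ℝ) →ₗ[ℝ] V)
    (N : (ι → ℝ) →ₗ[ℝ] (Fin m → ℝ)) (hN : ∀ w, N w = 0 → (∀ j, 0 ≤ w j) → w = 0)
    (C : Fin k → Set V) (hconv : ∀ i, Convex ℝ (C i)) (hclosed : ∀ i, IsClosed (C i))
    (z : ι → ℝ) (hz : ∀ j, 0 ≤ z j) (hzC : ∀ i, Φ z ∉ C i) :
    ∃ z' : ι → ℝ, (∀ j, 0 ≤ z' j) ∧ N z' = N z ∧ (∀ i, Φ z' ∉ C i) ∧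
      (Finset.univ.filter fun j => z' j ≠ 0).card < m + k := by
  classical
  induction hn : (Finset.univ.filter fun j => z j ≠ 0).card using Nat.strong_induction_on
    generalizing z with
  | _ n ih =>
  by_cases hlt : n < m + k
  · exact ⟨z, hz, rfl, hzC, hn ▸ hlt⟩
  choose f u hfu hux using fun i => geometric_hahn_banach_closed_point (hconv i) (hclosed i) (hzC i)
  let S := {j // z j ≠ 0}
  let ext : (S → ℝ) →ₗ[ℝ] (ι → ℝ) := Function.ExtendByZero.linearMap ℝ Subtype.val
  let M : (S → ℝ) →ₗ[ℝ] (Fin m → ℝ) × (Fin k → ℝ) :=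
    (N ∘ₗ ext).prod (LinearMap.pi fun i => (f i : V →ₗ[ℝ] ℝ) ∘ₗ Φ ∘ₗ ext)
  have hcard : m + k ≤ Fintype.card S := by
    rw [Fintype.card_subtype]; omega
  have hc : ((0, 1) : (Fin m → ℝ) × (Fin k → ℝ)) ≠ 0 := by
    intro h
    simpa using congrFun (congrArg Prod.snd h) ⟨0, hk⟩
  obtain ⟨v, hv0, hv⟩ := exists_ne_zero_map_eq_zero_or_eq M (by simpa using hcard) hc
  set w := ext v with hw
  have hext : ∀ j : S, w j = v j := fun j => Subtype.val_injective.extend_apply v 0 j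
  have hext0 : ∀ j, z j = 0 → w j = 0 := fun j hj =>
    Function.extend_apply' (f := (Subtype.val : S → ι)) v 0 j (by rintro ⟨a, rfl⟩; exact a.2 hj)
  have hNw : N w = 0 := by
    rcases hv with hv | hv <;> exact congrArg Prod.fst hv
  have hfw : ∀ i, 0 ≤ f i (Φ w) := fun i => by
    rcases hv with hv | hv
    · exact (congrFun (congrArg Prod.snd hv) i).ge
    · have : f i (Φ w) = 1 := congrFun (congrArg Prod.snd hv) i
      linarith
  have hneg : ∃ j, w j < 0 := by
    by_contra! h
    refine hv0 (funext fun j => ?_)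
    rw [← hext, hN w hNw h]
    rfl
  obtain ⟨t, ht, htz, j, hj, hjt⟩ := exists_exit_nonneg_orthant hz hneg
  have hN' : N (z + t • w) = N z := by simp [hNw]
  have hlt' : (Finset.univ.filter fun j => (z + t • w) j ≠ 0).card < n := by
    rw [← hn]
    refine Finset.card_lt_card (Finset.ssubset_iff_of_subset ?_ |>.2 ⟨j, ?_, ?_⟩)
    · intro i
      simp only [Finset.mem_filter, Finset.mem_univ, true_and, Pi.add_apply, Pi.smul_apply,
        smul_eq_mul]
      intro hi hzi
      exact hi (by rw [hzi, hext0 i hzi]; ring)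
    · simp only [Finset.mem_filter, Finset.mem_univ, true_and]
      intro hzj
      exact hj.ne (hext0 j hzj)
    · simpa using hjt
  have hnotMem : ∀ i, Φ (z + t • w) ∉ C i := by
    intro i hi
    have h := hfu i _ hi
    simp only [map_add, map_smul, smul_eq_mul] at h
    have := mul_nonneg ht (hfw i)
    linarith [hux i]
  obtain ⟨z', h1, h2, h3, h4⟩ :=
    ih _ hlt' (z + t • w) (fun j => by simpa using htz j) hnotMem rfl
  exact ⟨z', h1, h2.trans hN', h3, h4⟩

open scoped RealInnerProductSpace in
/-- A first-order upper bound for the norm. -/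
theorem norm_add_smul_le {F : Type*} [NormedAddCommGroup F] [InnerProductSpace ℝ F]
    {v : F} (hv : v ≠ 0) (w : F) (t : ℝ) :
    ‖v + t • w‖ ≤ ‖v‖ + t * (⟪v, w⟫ / ‖v‖) + t ^ 2 * (‖w‖ ^ 2 / (2 * ‖v‖)) := by
  have h0 : 0 < ‖v‖ := norm_pos_iff.2 hv
  have h1 : ‖v + t • w‖ ^ 2 = ‖v‖ ^ 2 + 2 * (t * ⟪v, w⟫) + t ^ 2 * ‖w‖ ^ 2 := by
    rw [norm_add_sq_real, inner_smul_right, norm_smul, mul_pow, Real.norm_eq_abs, sq_abs]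
  have h2 : ‖v‖ + t * (⟪v, w⟫ / ‖v‖) + t ^ 2 * (‖w‖ ^ 2 / (2 * ‖v‖))
      = (‖v‖ ^ 2 + ‖v + t • w‖ ^ 2) / (2 * ‖v‖) := by
    rw [h1]; field_simp; ring
  rw [h2, le_div_iff₀ (by positivity)]
  nlinarith [sq_nonneg (‖v‖ - ‖v + t • w‖)]

theorem nonneg_of_forall_mul_add_sq_mul_nonneg {S K : ℝ}
    (h : ∀ t : ℝ, 0 < t → t ≤ 1 → 0 ≤ t * S + t ^ 2 * K) : 0 ≤ S := by
  by_contra! hS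
  have hK := h 1 one_pos le_rfl
  have hK0 : 0 < K := by nlinarith
  have ht : 0 < -S / (2 * K) := by apply div_pos <;> linarith
  have h1 : -S / (2 * K) ≤ 1 := by
    rw [div_le_one (by linarith)]; linarith
  have h2 := h _ ht h1
  have : -S / (2 * K) * S + (-S / (2 * K)) ^ 2 * K = -(S ^ 2 / (4 * K)) := by
    field_simp; ring
  rw [this] at h2
  have : 0 < S ^ 2 / (4 * K) := div_pos (sq_pos_of_neg hS) (by linarith)
  linarith

open scoped RealInnerProductSpace in
/-- Straightening a shortest broken line `y p c` along the ray from `y` through `p` does not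
increase the distance of its endpoint to the points towards which `p` could have been moved. -/
theorem norm_straighten_sub_le {F : Type*} [NormedAddCommGroup F] [InnerProductSpace ℝ F]
    {y p c a : F} (hyp : p ≠ y)
    (hmin : ∀ t : ℝ, 0 < t → t ≤ 1 →
      ‖p - y‖ + ‖p - c‖ ≤ ‖p + t • (a - p) - y‖ + ‖p + t • (a - p) - c‖) :
    ‖y + ((‖p - y‖ + ‖p - c‖) / ‖p - y‖) • (p - y) - a‖ ≤ ‖c - a‖ := by
  have hv : p - y ≠ 0 := sub_ne_zero.2 hyp
  have hv0 : 0 < ‖p - y‖ := norm_pos_iff.2 hv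
  have hC : y + ((‖p - y‖ + ‖p - c‖) / ‖p - y‖) • (p - y) - a
      = (‖p - c‖ / ‖p - y‖) • (p - y) - (a - p) := by
    rw [add_div, div_self hv0.ne', add_smul, one_smul]; abel
  rw [hC]
  by_cases hpc : p = c
  · subst hpc; simp [norm_sub_rev]
  have hu : p - c ≠ 0 := sub_ne_zero.2 hpc
  have hu0 : 0 < ‖p - c‖ := norm_pos_iff.2 hu
  have hS : 0 ≤ ⟪p - y, a - p⟫ / ‖p - y‖ + ⟪p - c, a - p⟫ / ‖p - c‖ := by
    refine nonneg_of_forall_mul_add_sq_mul_nonneg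
      (K := ‖a - p‖ ^ 2 / (2 * ‖p - y‖) + ‖a - p‖ ^ 2 / (2 * ‖p - c‖)) fun t ht ht1 => ?_
    have h := hmin t ht ht1
    rw [add_sub_right_comm p _ y, add_sub_right_comm p _ c] at h
    linarith [norm_add_smul_le hv (a - p) t, norm_add_smul_le hu (a - p) t]
  rw [← sq_le_sq₀ (norm_nonneg _) (norm_nonneg _), norm_sub_sq_real, norm_smul,
    real_inner_smul_left, Real.norm_of_nonneg (by positivity), div_mul_cancel₀ _ hv0.ne']
  have h2 : ‖c - a‖ ^ 2 = ‖p - c‖ ^ 2 + 2 * ⟪p - c, a - p⟫ + ‖a - p‖ ^ 2 := by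
    rw [← norm_add_sq_real, norm_sub_rev c a]; congr 2; abel
  rw [h2]
  have h3 : 0 ≤ ‖p - c‖ / ‖p - y‖ * ⟪p - y, a - p⟫ + ⟪p - c, a - p⟫ := by
    have := mul_nonneg hu0.le hS
    have e : ‖p - c‖ * (⟪p - y, a - p⟫ / ‖p - y‖ + ⟪p - c, a - p⟫ / ‖p - c‖)
      = ‖p - c‖ / ‖p - y‖ * ⟪p - y, a - p⟫ + ⟪p - c, a - p⟫ := by field_simp
    linarith
  linarith

open scoped RealInnerProductSpace in
/-- If `v` makes an angle of at least `60°` with `a` and its end is within `δ` of `a`, then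
`‖v‖ ≤ 2 δ / √3`. -/
theorem norm_sq_le_of_inner_le_half {F : Type*} [NormedAddCommGroup F] [InnerProductSpace ℝ F]
    {v a : F} {δ : ℝ} (hin : ⟪v, a⟫ ≤ ‖v‖ * ‖a‖ / 2) (h : ‖v - a‖ ≤ δ) :
    3 * ‖v‖ ^ 2 ≤ 4 * δ ^ 2 := by
  have h1 : ‖v - a‖ ^ 2 ≤ δ ^ 2 := by gcongr
  rw [norm_sub_sq_real] at h1
  nlinarith [sq_nonneg (‖a‖ - ‖v‖ / 2)]

open scoped RealInnerProductSpace in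
/-- Splitting an angle of at least `120°` leaves a part of at least `60°`. -/
theorem inner_le_half_of_inner_le_neg_half {F : Type*} [NormedAddCommGroup F]
    [InnerProductSpace ℝ F] {a b : F} {s t : ℝ} (hs : 0 ≤ s) (ht : 0 ≤ t)
    (hab : ⟪a, b⟫ ≤ -(‖a‖ * ‖b‖ / 2)) :
    ⟪s • a + t • b, a⟫ ≤ ‖s • a + t • b‖ * ‖a‖ / 2 ∨
      ⟪s • a + t • b, b⟫ ≤ ‖s • a + t • b‖ * ‖b‖ / 2 := by
  by_contra! h
  obtain ⟨h1, h2⟩ := h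
  set v := s • a + t • b with hv
  have e1 : ⟪v, a⟫ = s * ‖a‖ ^ 2 + t * ⟪a, b⟫ := by
    rw [hv, inner_add_left, real_inner_smul_left, real_inner_smul_left,
      real_inner_self_eq_norm_sq, real_inner_comm]
  have e2 : ⟪v, b⟫ = s * ⟪a, b⟫ + t * ‖b‖ ^ 2 := by
    rw [hv, inner_add_left, real_inner_smul_left, real_inner_smul_left,
      real_inner_self_eq_norm_sq]
  have e3 : ‖v‖ ^ 2 = s * ⟪v, a⟫ + t * ⟪v, b⟫ := by
    rw [← real_inner_self_eq_norm_sq]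
    nth_rw 2 [hv]
    rw [inner_add_right, inner_smul_right, inner_smul_right]
  have ha : 0 < ‖a‖ := by
    rcases (norm_nonneg a).lt_or_eq with h | h
    · exact h
    · rw [norm_eq_zero.1 h.symm] at h1; simp at h1
  have hb : 0 < ‖b‖ := by
    rcases (norm_nonneg b).lt_or_eq with h | h
    · exact h
    · rw [norm_eq_zero.1 h.symm] at h2; simp at h2
  have hv0 : 0 ≤ ‖v‖ := norm_nonneg v
  have k1 : ‖v‖ / 2 < s * ‖a‖ - t * ‖b‖ / 2 := by
    have : ‖a‖ * (‖v‖ / 2) < ‖a‖ * (s * ‖a‖ - t * ‖b‖ / 2) := by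
      nlinarith [mul_le_mul_of_nonneg_left hab ht]
    exact lt_of_mul_lt_mul_left this ha.le
  have k2 : ‖v‖ / 2 < t * ‖b‖ - s * ‖a‖ / 2 := by
    have : ‖b‖ * (‖v‖ / 2) < ‖b‖ * (t * ‖b‖ - s * ‖a‖ / 2) := by
      nlinarith [mul_le_mul_of_nonneg_left hab hs]
    exact lt_of_mul_lt_mul_left this hb.le
  have k3 : ‖v‖ * ((s * ‖a‖ + t * ‖b‖) / 2) ≤ ‖v‖ ^ 2 := by
    rw [e3]
    nlinarith [mul_le_mul_of_nonneg_left h1.le hs, mul_le_mul_of_nonneg_left h2.le ht]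
  rcases hv0.lt_or_eq with hp | hp
  · have : (s * ‖a‖ + t * ‖b‖) / 2 ≤ ‖v‖ := by
      rw [sq] at k3
      exact le_of_mul_le_mul_left k3 hp
    linarith
  · have hv' : v = 0 := norm_eq_zero.1 hp.symm
    rw [hv'] at h1
    simp at h1

open scoped RealInnerProductSpace in
/-- If `y` sees the segment `[a, b]` under an angle of at least `120°`, then the shortest broken
line from `y` to `c` through that segment has length at most `2 δ / √3`. -/
theorem exists_broken_line_of_inner_le {F : Type*} [NormedAddCommGroup F] [InnerProductSpace ℝ F]
    {a b c y : F} {δ : ℝ} (hca : ‖c - a‖ ≤ δ) (hcb : ‖c - b‖ ≤ δ)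
    (hab : ⟪a - y, b - y⟫ ≤ -(‖a - y‖ * ‖b - y‖ / 2)) :
    ∃ p ∈ segment ℝ a b, ‖p - y‖ + ‖p - c‖ ≤ 2 / √3 * δ := by
  have hδ : 0 ≤ δ := (norm_nonneg _).trans hca
  have hcomp : IsCompact (segment ℝ a b) := by
    rw [segment_eq_image_lineMap]
    exact isCompact_Icc.image AffineMap.lineMap_continuous
  obtain ⟨p, hp, hpmin⟩ := hcomp.exists_isMinOn ⟨a, left_mem_segment ℝ a b⟩
    (f := fun p => ‖p - y‖ + ‖p - c‖) (by fun_prop)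
  refine ⟨p, hp, ?_⟩
  set L := ‖p - y‖ + ‖p - c‖ with hL
  have hL0 : 0 ≤ L := by positivity
  suffices h : 3 * L ^ 2 ≤ 4 * δ ^ 2 by
    have h3 : (0 : ℝ) < √3 := by positivity
    rw [div_mul_eq_mul_div, le_div_iff₀ h3, ← sq_le_sq₀ (by positivity) (by positivity), mul_pow,
      Real.sq_sqrt (by norm_num)]
    linarith
  by_cases hpy : p = y
  · have hle : L ≤ δ := by
      have h := (convex_closedBall c δ).segment_subset
        (by rwa [mem_closedBall_iff_norm, norm_sub_rev] : a ∈ _)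
        (by rwa [mem_closedBall_iff_norm, norm_sub_rev] : b ∈ _) hp
      rw [mem_closedBall_iff_norm] at h
      rwa [hL, hpy, sub_self, norm_zero, zero_add, ← hpy]
    nlinarith
  have hmove : ∀ e ∈ segment ℝ a b, ∀ t : ℝ, 0 < t → t ≤ 1 →
      ‖p - y‖ + ‖p - c‖ ≤ ‖p + t • (e - p) - y‖ + ‖p + t • (e - p) - c‖ := by
    intro e he t ht ht1
    refine hpmin ((convex_segment a b).add_smul_sub_mem hp he ⟨ht.le, ht1⟩)
  have ha := norm_straighten_sub_le hpy (hmove a (left_mem_segment ℝ a b))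
  have hb := norm_straighten_sub_le hpy (hmove b (right_mem_segment ℝ a b))
  have hpy0 : 0 < ‖p - y‖ := norm_pos_iff.2 (sub_ne_zero.2 hpy)
  obtain ⟨s, t, hs, ht, hst, rfl⟩ := hp
  set p := s • a + t • b with hpdef
  have hpe : p - y = s • (a - y) + t • (b - y) := by
    have : y = s • y + t • y := by rw [← add_smul, hst, one_smul]
    nth_rw 1 [this]
    rw [hpdef, smul_sub, smul_sub]; abel
  set v := (L / ‖p - y‖) • (p - y) with hvdef
  have hr : 0 ≤ L / ‖p - y‖ := by positivity
  have hvn : ‖v‖ = L := by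
    rw [hvdef, norm_smul, Real.norm_of_nonneg hr, div_mul_cancel₀ _ hpy0.ne']
  have hve : v = (L / ‖p - y‖ * s) • (a - y) + (L / ‖p - y‖ * t) • (b - y) := by
    rw [hvdef, hpe, smul_add, smul_smul, smul_smul]
  rw [← hvn]
  have hrew : ∀ e, y + v - e = v - (e - y) := fun e => by abel
  rw [hrew] at ha hb
  rcases inner_le_half_of_inner_le_neg_half (mul_nonneg hr hs) (mul_nonneg hr ht) hab with h | h
  · rw [← hve] at h
    exact norm_sq_le_of_inner_le_half h (ha.trans hca)
  · rw [← hve] at h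
    exact norm_sq_le_of_inner_le_half h (hb.trans hcb)

open scoped RealInnerProductSpace in
/-- Among three vectors with a vanishing convex combination, two make an angle of at least
`120°`. -/
theorem exists_inner_le_neg_half {F : Type*} [NormedAddCommGroup F] [InnerProductSpace ℝ F]
    {a b d : F} {r s t : ℝ} (hr : 0 ≤ r) (hs : 0 ≤ s) (ht : 0 ≤ t) (hsum : r + s + t = 1)
    (h0 : r • a + s • b + t • d = 0) :
    ⟪a, b⟫ ≤ -(‖a‖ * ‖b‖ / 2) ∨ ⟪a, d⟫ ≤ -(‖a‖ * ‖d‖ / 2) ∨ ⟪b, d⟫ ≤ -(‖b‖ * ‖d‖ / 2) := by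
  by_contra! h
  obtain ⟨h1, h2, h3⟩ := h
  have hna : a ≠ 0 := by rintro rfl; simp at h1
  have hnb : b ≠ 0 := by rintro rfl; simp at h1
  have hnd : d ≠ 0 := by rintro rfl; simp at h2
  have ha : 0 < ‖a‖ := norm_pos_iff.2 hna
  have hb : 0 < ‖b‖ := norm_pos_iff.2 hnb
  have hd : 0 < ‖d‖ := norm_pos_iff.2 hnd
  have hexp : ‖r • a + s • b + t • d‖ ^ 2 = (r * ‖a‖) ^ 2 + (s * ‖b‖) ^ 2 + (t * ‖d‖) ^ 2
      + 2 * (r * s * ⟪a, b⟫ + r * t * ⟪a, d⟫ + s * t * ⟪b, d⟫) := by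
    rw [norm_add_sq_real, norm_add_sq_real]
    simp only [inner_add_left, inner_smul_left, inner_smul_right, norm_smul, Real.norm_eq_abs,
      mul_pow, sq_abs, conj_trivial]
    ring
  rw [h0, norm_zero] at hexp
  have i1 := mul_le_mul_of_nonneg_left h1.le (mul_nonneg hr hs)
  have i2 := mul_le_mul_of_nonneg_left h2.le (mul_nonneg hr ht)
  have i3 := mul_le_mul_of_nonneg_left h3.le (mul_nonneg hs ht)
  have hab : r * ‖a‖ = s * ‖b‖ := by
    nlinarith [sq_nonneg (r * ‖a‖ - s * ‖b‖), sq_nonneg (r * ‖a‖ - t * ‖d‖),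
      sq_nonneg (s * ‖b‖ - t * ‖d‖)]
  have had : r * ‖a‖ = t * ‖d‖ := by
    nlinarith [sq_nonneg (r * ‖a‖ - s * ‖b‖), sq_nonneg (r * ‖a‖ - t * ‖d‖),
      sq_nonneg (s * ‖b‖ - t * ‖d‖)]
  have hr0 : 0 < r := by
    rcases hr.lt_or_eq with h | rfl
    · exact h
    · rw [zero_mul] at hab had
      have : s = 0 := by
        rcases mul_eq_zero.1 hab.symm with h | h
        · exact h
        · exact absurd h hb.ne'
      have : t = 0 := by
        rcases mul_eq_zero.1 had.symm with h | h
        · exact h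
        · exact absurd h hd.ne'
      linarith
  have hs0 : 0 < s := by
    by_contra! hs'
    have : s = 0 := le_antisymm hs' hs
    rw [this, zero_mul] at hab
    exact (mul_pos hr0 ha).ne' hab
  have j1 := mul_lt_mul_of_pos_left h1 (mul_pos hr0 hs0)
  nlinarith [sq_nonneg (r * ‖a‖ - s * ‖b‖), sq_nonneg (r * ‖a‖ - t * ‖d‖),
      sq_nonneg (s * ‖b‖ - t * ‖d‖)]

/-- From a point `y` of a triangle `a b d` one reaches a point `c` at distance at most `δ` from the
vertices by a broken line of length at most `2 δ / √3` through one of the sides. -/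
theorem exists_broken_line_to_apex {F : Type*} [NormedAddCommGroup F] [InnerProductSpace ℝ F]
    {a b c d y : F} {δ r s t : ℝ} (hca : ‖c - a‖ ≤ δ) (hcb : ‖c - b‖ ≤ δ) (hcd : ‖c - d‖ ≤ δ)
    (hr : 0 ≤ r) (hs : 0 ≤ s) (ht : 0 ≤ t) (hsum : r + s + t = 1)
    (hy : y = r • a + s • b + t • d) :
    (∃ p ∈ segment ℝ a b, ‖p - y‖ + ‖p - c‖ ≤ 2 / √3 * δ) ∨
      (∃ p ∈ segment ℝ a d, ‖p - y‖ + ‖p - c‖ ≤ 2 / √3 * δ) ∨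
      (∃ p ∈ segment ℝ b d, ‖p - y‖ + ‖p - c‖ ≤ 2 / √3 * δ) := by
  have h0 : r • (a - y) + s • (b - y) + t • (d - y) = 0 := by
    have : r • (a - y) + s • (b - y) + t • (d - y)
        = (r • a + s • b + t • d) - (r + s + t) • y := by module
    rw [this, ← hy, hsum, one_smul, sub_self]
  rcases exists_inner_le_neg_half hr hs ht hsum h0 with h | h | h
  · exact Or.inl (exists_broken_line_of_inner_le hca hcb h)
  · exact Or.inr (Or.inl (exists_broken_line_of_inner_le hca hcd h))
  · exact Or.inr (Or.inr (exists_broken_line_of_inner_le hcb hcd h))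

/-- Pairs of points joined by a broken line of length at most `R` with its first breakpoint in `s`
and its second one in `t`. -/
def brokenLinePairs {F : Type*} [NormedAddCommGroup F] (s t : Set F) (R : ℝ) : Set (F × F) :=
  {z | ∃ q ∈ s, ∃ r ∈ t, ‖z.1 - q‖ + ‖q - r‖ + ‖r - z.2‖ ≤ R}

theorem convex_brokenLinePairs {F : Type*} [NormedAddCommGroup F] [NormedSpace ℝ F] {s t : Set F}
    (hs : Convex ℝ s) (ht : Convex ℝ t) (R : ℝ) : Convex ℝ (brokenLinePairs s t R) := by
  rintro ⟨x, y⟩ ⟨q, hq, r, hr, h⟩ ⟨x', y'⟩ ⟨q', hq', r', hr', h'⟩ a b ha hb hab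
  refine ⟨a • q + b • q', hs hq hq' ha hb hab, a • r + b • r', ht hr hr' ha hb hab, ?_⟩
  have key : ∀ u v u' v' : F, ‖(a • u + b • u') - (a • v + b • v')‖
      ≤ a * ‖u - v‖ + b * ‖u' - v'‖ := fun u v u' v' => by
    have e : (a • u + b • u') - (a • v + b • v') = a • (u - v) + b • (u' - v') := by module
    rw [e]
    refine (norm_add_le _ _).trans_eq ?_
    rw [norm_smul, norm_smul, Real.norm_of_nonneg ha, Real.norm_of_nonneg hb]
  have k1 := key x q x' q'
  have k2 := key q r q' r'
  have k3 := key r y r' y'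
  have h1 := mul_le_mul_of_nonneg_left h ha
  have h2 := mul_le_mul_of_nonneg_left h' hb
  have : a * R + b * R = R := by rw [← add_mul, hab, one_mul]
  change ‖(a • x + b • x') - _‖ + _ + ‖_ - (a • y + b • y')‖ ≤ R
  dsimp only at h1 h2
  linarith

theorem isClosed_brokenLinePairs {F : Type*} [NormedAddCommGroup F] {s t : Set F}
    (hs : IsCompact s) (ht : IsCompact t) (R : ℝ) : IsClosed (brokenLinePairs s t R) := by
  have := isCompact_iff_compactSpace.1 hs
  have := isCompact_iff_compactSpace.1 ht
  have h : IsClosed {w : (s × t) × (F × F) |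
      ‖w.2.1 - w.1.1‖ + ‖(w.1.1 : F) - w.1.2‖ + ‖(w.1.2 : F) - w.2.2‖ ≤ R} :=
    isClosed_le (by fun_prop) continuous_const
  convert isClosedMap_snd_of_compactSpace _ h using 1
  ext z
  constructor
  · rintro ⟨q, hq, r, hr, h⟩
    exact ⟨((⟨q, hq⟩, ⟨r, hr⟩), z), h, rfl⟩
  · rintro ⟨⟨⟨q, r⟩, w⟩, h, rfl⟩
    exact ⟨q, q.2, r, r.2, h⟩

theorem isCompact_segment {F : Type*} [NormedAddCommGroup F] [NormedSpace ℝ F] (a b : F) :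
    IsCompact (segment ℝ a b) := by
  rw [segment_eq_image_lineMap]
  exact isCompact_Icc.image AffineMap.lineMap_continuous

theorem brokenLinePairs_mono {F : Type*} [NormedAddCommGroup F] (s t : Set F) {R R' : ℝ}
    (h : R ≤ R') : brokenLinePairs s t R ⊆ brokenLinePairs s t R' := by
  rintro z ⟨q, hq, r, hr, hz⟩
  exact ⟨q, hq, r, hr, hz.trans h⟩

theorem norm_sub_le_of_mem_segment_of_le {F : Type*} [NormedAddCommGroup F] [NormedSpace ℝ F]
    {a b c x : F} {δ : ℝ} (hx : x ∈ segment ℝ a b) (ha : ‖c - a‖ ≤ δ) (hb : ‖c - b‖ ≤ δ) :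
    ‖c - x‖ ≤ δ := by
  have h := (convex_closedBall c δ).segment_subset
    (by rwa [mem_closedBall_iff_norm, norm_sub_rev] : a ∈ _)
    (by rwa [mem_closedBall_iff_norm, norm_sub_rev] : b ∈ _) hx
  rwa [mem_closedBall_iff_norm, norm_sub_rev] at h

theorem norm_sub_le_of_convex_combination {F : Type*} [NormedAddCommGroup F] [NormedSpace ℝ F]
    {a b c e : F} {r s t δ : ℝ} (hr : 0 ≤ r) (hs : 0 ≤ s) (ht : 0 ≤ t) (hsum : r + s + t = 1)
    (ha : ‖e - a‖ ≤ δ) (hb : ‖e - b‖ ≤ δ) (hc : ‖e - c‖ ≤ δ) :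
    ‖e - (r • a + s • b + t • c)‖ ≤ δ := by
  have h : e - (r • a + s • b + t • c) = r • (e - a) + s • (e - b) + t • (e - c) := by
    have : e = (r + s + t) • e := by rw [hsum, one_smul]
    nth_rw 1 [this]
    module
  rw [h]
  refine (norm_add₃_le).trans ?_
  rw [norm_smul, norm_smul, norm_smul, Real.norm_of_nonneg hr, Real.norm_of_nonneg hs,
    Real.norm_of_nonneg ht]
  have : δ = r * δ + s * δ + t * δ := by rw [← add_mul, ← add_mul, hsum, one_mul]
  rw [this]
  gcongr

/-- Two points on opposite edges `a c` and `b d` are joined by a broken line of length at most `δ`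
through one of the edges `a d` and `b c`. -/
theorem mem_brokenLinePairs_of_opposite {F : Type*} [NormedAddCommGroup F] [NormedSpace ℝ F]
    {a b c d x y : F} {δ : ℝ} (hab : ‖a - b‖ ≤ δ) (had : ‖a - d‖ ≤ δ)
    (hbc : ‖b - c‖ ≤ δ) (hcd : ‖c - d‖ ≤ δ)
    (hx : x ∈ segment ℝ a c) (hy : y ∈ segment ℝ b d) :
    (x, y) ∈ brokenLinePairs (segment ℝ a c) (segment ℝ a d) δ ∨
      (x, y) ∈ brokenLinePairs (segment ℝ b c) (segment ℝ b d) δ := by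
  by_contra! hcon
  obtain ⟨s, t, hs, ht, hst, rfl⟩ := hx
  obtain ⟨u, v, hu, hv, huv, rfl⟩ := hy
  let π (i : Fin 4) : (Fin 4 → ℝ) →ₗ[ℝ] ℝ := LinearMap.proj i
  let Φ : (Fin 4 → ℝ) →ₗ[ℝ] F × F :=
    LinearMap.prod
      ((π 0).smulRight a + (π 1).smulRight c)
      ((π 2).smulRight b + (π 3).smulRight d)
  let N : (Fin 4 → ℝ) →ₗ[ℝ] (Fin 2 → ℝ) :=
    LinearMap.pi ![π 0 + π 1,
      π 2 + π 3]
  have hN0 : ∀ z, N z 0 = z 0 + z 1 := fun z => rfl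
  have hN1 : ∀ z, N z 1 = z 2 + z 3 := fun z => rfl
  obtain ⟨z, hz, hNz, hzC, hcard⟩ := exists_small_support_notMem (k := 2) two_pos Φ N
    (fun w hw h => by
      have h0 : w 0 + w 1 = 0 := congrFun hw 0
      have h1 : w 2 + w 3 = 0 := congrFun hw 1
      funext j
      fin_cases j <;> simp <;> linarith [h 0, h 1, h 2, h 3])
    ![brokenLinePairs (segment ℝ a c) (segment ℝ a d) δ,
      brokenLinePairs (segment ℝ b c) (segment ℝ b d) δ]
    (fun i => by
      fin_cases i <;> exact convex_brokenLinePairs (convex_segment _ _) (convex_segment _ _) _)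
    (fun i => by
      fin_cases i <;> exact isClosed_brokenLinePairs (isCompact_segment _ _)
        (isCompact_segment _ _) _)
    ![s, t, u, v]
    (fun j => by fin_cases j <;> assumption)
    (fun i => by fin_cases i; exacts [hcon.1, hcon.2])
  have e0 : z 0 + z 1 = 1 := by rw [← hN0, hNz, hN0]; exact hst
  have e1 : z 2 + z 3 = 1 := by rw [← hN1, hNz, hN1]; exact huv
  have hx : z 0 • a + z 1 • c ∈ segment ℝ a c := ⟨_, _, hz 0, hz 1, e0, rfl⟩
  have hy : z 2 • b + z 3 • d ∈ segment ℝ b d := ⟨_, _, hz 2, hz 3, e1, rfl⟩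
  have c0 : ((z 0 • a + z 1 • c, z 2 • b + z 3 • d) : F × F) ∉
    brokenLinePairs (segment ℝ a c) (segment ℝ a d) δ := hzC 0
  have c1 : ((z 0 • a + z 1 • c, z 2 • b + z 3 • d) : F × F) ∉
    brokenLinePairs (segment ℝ b c) (segment ℝ b d) δ := hzC 1
  set x := z 0 • a + z 1 • c with hxdef
  set y := z 2 • b + z 3 • d with hydef
  obtain ⟨j, hj⟩ : ∃ j, z j = 0 := by
    by_contra! h
    rw [Finset.filter_true_of_mem fun j _ => h j] at hcard
    simp at hcard
  fin_cases j
  · have hj : z 0 = 0 := hj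
    have hxc : x = c := by rw [hxdef, hj, show z 1 = 1 by linarith]; simp
    refine c1 ⟨c, right_mem_segment ℝ b c, y, hy, ?_⟩
    have := norm_sub_le_of_mem_segment_of_le hy (by rwa [norm_sub_rev] : ‖c - b‖ ≤ δ) hcd
    simpa [hxc] using this
  · have hj : z 1 = 0 := hj
    have hxa : x = a := by rw [hxdef, hj, show z 0 = 1 by linarith]; simp
    refine c0 ⟨a, left_mem_segment ℝ a c, a, left_mem_segment ℝ a d, ?_⟩
    have := norm_sub_le_of_mem_segment_of_le hy hab had
    simpa [hxa] using this
  · have hj : z 2 = 0 := hj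
    have hyd : y = d := by rw [hydef, hj, show z 3 = 1 by linarith]; simp
    refine c0 ⟨x, hx, d, right_mem_segment ℝ a d, ?_⟩
    have := norm_sub_le_of_mem_segment_of_le hx (by rwa [norm_sub_rev] : ‖d - a‖ ≤ δ)
      (by rwa [norm_sub_rev])
    simpa [hyd, norm_sub_rev] using this
  · have hj : z 3 = 0 := hj
    have hyb : y = b := by rw [hydef, hj, show z 2 = 1 by linarith]; simp
    refine c1 ⟨b, left_mem_segment ℝ b c, b, left_mem_segment ℝ b d, ?_⟩
    have := norm_sub_le_of_mem_segment_of_le hx (by rwa [norm_sub_rev] : ‖b - a‖ ≤ δ) hbc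
    simpa [hyb, norm_sub_rev] using this

theorem mem_convexHull_triple {F : Type*} [AddCommGroup F] [Module ℝ F] {a b c x : F}
    (hx : x ∈ convexHull ℝ {a, b, c}) :
    ∃ r s t : ℝ, 0 ≤ r ∧ 0 ≤ s ∧ 0 ≤ t ∧ r + s + t = 1 ∧ x = r • a + s • b + t • c := by
  rw [convexHull_insert (by simp), convexHull_pair, convexJoin_singleton_left] at hx
  simp only [Set.mem_iUnion] at hx
  obtain ⟨p, ⟨s, t, hs, ht, hst, rfl⟩, r, u, hr, hu, hru, rfl⟩ := hx
  refine ⟨r, u * s, u * t, hr, mul_nonneg hu hs, mul_nonneg hu ht, ?_, by module⟩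
  rw [add_assoc, ← mul_add, hst, mul_one, hru]

/-- Two points in the faces `a b c` and `a b d` of a tetrahedron whose edges have length at most
`δ` are joined by a broken line of length at most `2 δ / √3` crossing from one face to the other
either through the edge `a b` or through one of the two remaining faces. -/
theorem mem_brokenLinePairs_of_faces {F : Type*} [NormedAddCommGroup F] [InnerProductSpace ℝ F]
    {a b c d x y : F} {δ : ℝ} (hab : ‖a - b‖ ≤ δ) (hac : ‖a - c‖ ≤ δ) (had : ‖a - d‖ ≤ δ)
    (hbc : ‖b - c‖ ≤ δ) (hbd : ‖b - d‖ ≤ δ) (hcd : ‖c - d‖ ≤ δ)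
    (hx : x ∈ convexHull ℝ {a, b, c}) (hy : y ∈ convexHull ℝ {a, b, d}) :
    (x, y) ∈ brokenLinePairs (segment ℝ a b) (segment ℝ a b) (2 / √3 * δ) ∨
      (x, y) ∈ brokenLinePairs (segment ℝ a c) (segment ℝ a d) (2 / √3 * δ) ∨
      (x, y) ∈ brokenLinePairs (segment ℝ b c) (segment ℝ b d) (2 / √3 * δ) := by
  have hδ : 0 ≤ δ := (norm_nonneg _).trans hab
  have hR : δ ≤ 2 / √3 * δ := by
    refine le_mul_of_one_le_left hδ ?_
    rw [le_div_iff₀ (by positivity), one_mul, Real.sqrt_le_left (by norm_num)]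
    norm_num
  have hba : ‖b - a‖ ≤ δ := by rwa [norm_sub_rev]
  have hca : ‖c - a‖ ≤ δ := by rwa [norm_sub_rev]
  have hda : ‖d - a‖ ≤ δ := by rwa [norm_sub_rev]
  have hcb : ‖c - b‖ ≤ δ := by rwa [norm_sub_rev]
  have hdb : ‖d - b‖ ≤ δ := by rwa [norm_sub_rev]
  have hdc : ‖d - c‖ ≤ δ := by rwa [norm_sub_rev]
  by_contra! hcon
  obtain ⟨u₀, u₁, u₂, hu₀, hu₁, hu₂, hu, rfl⟩ := mem_convexHull_triple hx
  obtain ⟨v₀, v₁, v₂, hv₀, hv₁, hv₂, hv, rfl⟩ := mem_convexHull_triple hy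
  let π (i : Fin 6) : (Fin 6 → ℝ) →ₗ[ℝ] ℝ := LinearMap.proj i
  let Φ : (Fin 6 → ℝ) →ₗ[ℝ] F × F :=
    LinearMap.prod
      ((π 0).smulRight a + (π 1).smulRight b
        + (π 2).smulRight c)
      ((π 3).smulRight a + (π 4).smulRight b
        + (π 5).smulRight d)
  let N : (Fin 6 → ℝ) →ₗ[ℝ] (Fin 2 → ℝ) :=
    LinearMap.pi ![π 0 + π 1 + π 2, π 3 + π 4 + π 5]
  have hN0 : ∀ z, N z 0 = z 0 + z 1 + z 2 := fun z => rfl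
  have hN1 : ∀ z, N z 1 = z 3 + z 4 + z 5 := fun z => rfl
  obtain ⟨z, hz, hNz, hzC, hcard⟩ := exists_small_support_notMem (k := 3) three_pos Φ N
    (fun w hw h => by
      have h0 : w 0 + w 1 + w 2 = 0 := congrFun hw 0
      have h1 : w 3 + w 4 + w 5 = 0 := congrFun hw 1
      funext j
      fin_cases j <;> simp <;> linarith [h 0, h 1, h 2, h 3, h 4, h 5])
    ![brokenLinePairs (segment ℝ a b) (segment ℝ a b) (2 / √3 * δ),
      brokenLinePairs (segment ℝ a c) (segment ℝ a d) (2 / √3 * δ),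
      brokenLinePairs (segment ℝ b c) (segment ℝ b d) (2 / √3 * δ)]
    (fun i => by
      fin_cases i <;> exact convex_brokenLinePairs (convex_segment _ _) (convex_segment _ _) _)
    (fun i => by
      fin_cases i <;> exact isClosed_brokenLinePairs (isCompact_segment _ _)
        (isCompact_segment _ _) _)
    ![u₀, u₁, u₂, v₀, v₁, v₂]
    (fun j => by fin_cases j <;> assumption)
    (fun i => by fin_cases i; exacts [hcon.1, hcon.2.1, hcon.2.2])
  have e0 : z 0 + z 1 + z 2 = 1 := by rw [← hN0, hNz, hN0]; exact hu
  have e1 : z 3 + z 4 + z 5 = 1 := by rw [← hN1, hNz, hN1]; exact hv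
  obtain ⟨x, hxdef⟩ : ∃ x, x = z 0 • a + z 1 • b + z 2 • c := ⟨_, rfl⟩
  obtain ⟨y, hydef⟩ : ∃ y, y = z 3 • a + z 4 • b + z 5 • d := ⟨_, rfl⟩
  have hΦ : Φ z = (x, y) := by rw [hxdef, hydef]; rfl
  have c1 : (x, y) ∉ brokenLinePairs (segment ℝ a b) (segment ℝ a b) (2 / √3 * δ) :=
    hΦ ▸ hzC 0
  have c2 : (x, y) ∉ brokenLinePairs (segment ℝ a c) (segment ℝ a d) (2 / √3 * δ) :=
    hΦ ▸ hzC 1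
  have c3 : (x, y) ∉ brokenLinePairs (segment ℝ b c) (segment ℝ b d) (2 / √3 * δ) :=
    hΦ ▸ hzC 2
  have hx0 : z 0 = 0 → x ∈ segment ℝ b c := fun h =>
    ⟨z 1, z 2, hz 1, hz 2, by linarith, by simp [hxdef, h]⟩
  have hx1 : z 1 = 0 → x ∈ segment ℝ a c := fun h =>
    ⟨z 0, z 2, hz 0, hz 2, by linarith, by simp [hxdef, h]⟩
  have hx2 : z 2 = 0 → x ∈ segment ℝ a b := fun h =>
    ⟨z 0, z 1, hz 0, hz 1, by linarith, by simp [hxdef, h]⟩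
  have hy0 : z 3 = 0 → y ∈ segment ℝ b d := fun h =>
    ⟨z 4, z 5, hz 4, hz 5, by linarith, by simp [hydef, h]⟩
  have hy1 : z 4 = 0 → y ∈ segment ℝ a d := fun h =>
    ⟨z 3, z 5, hz 3, hz 5, by linarith, by simp [hydef, h]⟩
  have hy2 : z 5 = 0 → y ∈ segment ℝ a b := fun h =>
    ⟨z 3, z 4, hz 3, hz 4, by linarith, by simp [hydef, h]⟩
  have hδδ : ‖a - a‖ ≤ δ ∧ ‖b - b‖ ≤ δ ∧ ‖c - c‖ ≤ δ ∧ ‖d - d‖ ≤ δ := by simpa using hδ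
  obtain ⟨haa, hbb, hcc, hdd⟩ := hδδ
  have hax : ‖a - x‖ ≤ δ :=
    hxdef ▸ norm_sub_le_of_convex_combination (hz 0) (hz 1) (hz 2) e0 haa hab hac
  have hbx : ‖b - x‖ ≤ δ :=
    hxdef ▸ norm_sub_le_of_convex_combination (hz 0) (hz 1) (hz 2) e0 hba hbb hbc
  have hay : ‖a - y‖ ≤ δ :=
    hydef ▸ norm_sub_le_of_convex_combination (hz 3) (hz 4) (hz 5) e1 haa hab had
  have hby : ‖b - y‖ ≤ δ :=
    hydef ▸ norm_sub_le_of_convex_combination (hz 3) (hz 4) (hz 5) e1 hba hbb hbd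
  have hz2 : z 2 ≠ 0 := fun h => by
    refine c1 ⟨x, hx2 h, x, hx2 h, ?_⟩
    have := norm_sub_le_of_mem_segment_of_le (hx2 h) (norm_sub_rev a y ▸ hay)
      (norm_sub_rev b y ▸ hby)
    simpa [norm_sub_rev] using this.trans hR
  have hz5 : z 5 ≠ 0 := fun h => by
    refine c1 ⟨y, hy2 h, y, hy2 h, ?_⟩
    have := norm_sub_le_of_mem_segment_of_le (hy2 h) (norm_sub_rev a x ▸ hax)
      (norm_sub_rev b x ▸ hbx)
    simpa using this.trans hR
  have hxc : ¬(z 0 = 0 ∧ z 1 = 0) := by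
    rintro ⟨h0, h1⟩
    have hxc : x = c := by rw [hxdef, h0, h1, show z 2 = 1 by linarith]; simp
    rcases exists_broken_line_to_apex hca hcb hcd (hz 3) (hz 4) (hz 5) e1 hydef with
      ⟨p, hp, h⟩ | ⟨p, hp, h⟩ | ⟨p, hp, h⟩
    · refine c1 ⟨p, hp, p, hp, ?_⟩
      simpa [hxc, norm_sub_rev c p, add_comm] using h
    · refine c2 ⟨c, right_mem_segment ℝ a c, p, hp, ?_⟩
      simpa [hxc, norm_sub_rev c p, add_comm] using h
    · refine c3 ⟨c, right_mem_segment ℝ b c, p, hp, ?_⟩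
      simpa [hxc, norm_sub_rev c p, add_comm] using h
  have hyd : ¬(z 3 = 0 ∧ z 4 = 0) := by
    rintro ⟨h0, h1⟩
    have hyd : y = d := by rw [hydef, h0, h1, show z 5 = 1 by linarith]; simp
    rcases exists_broken_line_to_apex hda hdb hdc (hz 0) (hz 1) (hz 2) e0 hxdef with
      ⟨p, hp, h⟩ | ⟨p, hp, h⟩ | ⟨p, hp, h⟩
    · refine c1 ⟨p, hp, p, hp, ?_⟩
      simpa [hyd, norm_sub_rev x p] using h
    · refine c2 ⟨p, hp, d, right_mem_segment ℝ a d, ?_⟩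
      simpa [hyd, norm_sub_rev x p] using h
    · refine c3 ⟨p, hp, d, right_mem_segment ℝ b d, ?_⟩
      simpa [hyd, norm_sub_rev x p] using h
  have h03 : ¬(z 0 = 0 ∧ z 3 = 0) := by
    rintro ⟨h0, h3⟩
    refine c3 ⟨x, hx0 h0, y, hy0 h3, ?_⟩
    have := norm_sub_le_of_mem_segment_of_le (hx0 h0) (norm_sub_rev b y ▸ hby)
      (norm_sub_rev c y ▸ norm_sub_le_of_mem_segment_of_le (hy0 h3) hcb hcd)
    simpa [norm_sub_rev] using this.trans hR
  have h14 : ¬(z 1 = 0 ∧ z 4 = 0) := by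
    rintro ⟨h1, h4⟩
    refine c2 ⟨x, hx1 h1, y, hy1 h4, ?_⟩
    have := norm_sub_le_of_mem_segment_of_le (hx1 h1) (norm_sub_rev a y ▸ hay)
      (norm_sub_rev c y ▸ norm_sub_le_of_mem_segment_of_le (hy1 h4) hca hcd)
    simpa [norm_sub_rev] using this.trans hR
  have h13 : ¬(z 1 = 0 ∧ z 3 = 0) := by
    rintro ⟨h1, h3⟩
    rcases mem_brokenLinePairs_of_opposite hab had hbc hcd (hx1 h1) (hy0 h3) with h | h
    · exact c2 (brokenLinePairs_mono _ _ hR h)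
    · exact c3 (brokenLinePairs_mono _ _ hR h)
  have h04 : ¬(z 0 = 0 ∧ z 4 = 0) := by
    rintro ⟨h0, h4⟩
    rcases mem_brokenLinePairs_of_opposite hba hbd hac hcd (hx0 h0) (hy1 h4) with h | h
    · exact c3 (brokenLinePairs_mono _ _ hR h)
    · exact c2 (brokenLinePairs_mono _ _ hR h)
  rw [Finset.card_filter, Fin.sum_univ_six] at hcard
  by_cases k0 : z 0 = 0 <;> by_cases k1 : z 1 = 0 <;> by_cases k3 : z 3 = 0 <;>
    by_cases k4 : z 4 = 0 <;> simp_all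

theorem rho_le_eVariationOn {T : Set (EuclideanSpace ℝ (Fin 3))}
    {γ : ℝ → EuclideanSpace ℝ (Fin 3)} (hγ : Continuous γ) (hT : ∀ t ∈ Set.Icc (0 : ℝ) 1, γ t ∈ T) :
    rho T (γ 0) (γ 1) ≤ eVariationOn γ (Set.Icc 0 1) :=
  iInf_le_of_le γ <| iInf_le_of_le hγ <| iInf_le_of_le rfl <| iInf_le_of_le rfl <|
    iInf_le_of_le hT le_rfl

theorem edist_le_rho (T : Set (EuclideanSpace ℝ (Fin 3))) (x y : EuclideanSpace ℝ (Fin 3)) :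
    edist x y ≤ rho T x y := by
  refine le_iInf fun γ => le_iInf fun _ => le_iInf fun h0 => le_iInf fun h1 => le_iInf fun _ => ?_
  rw [← h0, ← h1]
  exact eVariationOn.edist_le γ (by simp) (by simp)

theorem rho_le_edist_of_segment_subset {T : Set (EuclideanSpace ℝ (Fin 3))}
    {x y : EuclideanSpace ℝ (Fin 3)} (h : segment ℝ x y ⊆ T) : rho T x y ≤ edist x y := by
  have hγ := rho_le_eVariationOn (T := T) (γ := AffineMap.lineMap (k := ℝ) x y)
    AffineMap.lineMap_continuous (fun t ht => h (by
      rw [segment_eq_image_lineMap]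
      exact ⟨t, ht, rfl⟩))
  rw [AffineMap.lineMap_apply_zero, AffineMap.lineMap_apply_one] at hγ
  refine hγ.trans ?_
  have h1 := ((lipschitzWith_lineMap (𝕜 := ℝ) x y).lipschitzOnWith
    (s := Set.univ)).comp_eVariationOn_le (g := id) (s := Set.Icc (0 : ℝ) 1)
    (fun _ _ => Set.mem_univ _)
  refine h1.trans ?_
  have h2 : eVariationOn (id : ℝ → ℝ) (Set.Icc 0 1) ≤ 1 := by
    simp
  calc _ ≤ (nndist x y : ℝ≥0∞) * 1 := by gcongr
    _ = edist x y := by rw [mul_one, edist_nndist]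

theorem rho_triangle (T : Set (EuclideanSpace ℝ (Fin 3))) (x y z : EuclideanSpace ℝ (Fin 3)) :
    rho T x z ≤ rho T x y + rho T y z := by
  rw [rho, rho, rho]
  simp only [ENNReal.iInf_add, ENNReal.add_iInf]
  refine le_iInf fun γ' => le_iInf fun hγ' => le_iInf fun h0' => le_iInf fun h1' =>
    le_iInf fun hT' => le_iInf fun γ => le_iInf fun hγ => le_iInf fun h0 => le_iInf fun h1 =>
    le_iInf fun hT => ?_
  let η : ℝ → EuclideanSpace ℝ (Fin 3) := fun t => if t ≤ 1 / 2 then γ (2 * t) else γ' (2 * t - 1)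
  have hη : Continuous η := by
    refine Continuous.if_le (by fun_prop) (by fun_prop) continuous_id continuous_const ?_
    rintro t rfl
    norm_num [h1, h0']
  have hηT : ∀ t ∈ Set.Icc (0 : ℝ) 1, η t ∈ T := by
    rintro t ⟨ht0, ht1⟩
    by_cases ht : t ≤ 1 / 2
    · simp only [η, if_pos ht]
      exact hT _ ⟨by linarith, by linarith⟩
    · simp only [η, if_neg ht]
      exact hT' _ ⟨by linarith, by linarith⟩
  have hη0 : η 0 = x := by simp [η, h0]
  have hη1 : η 1 = z := by norm_num [η, h1']
  have key := rho_le_eVariationOn hη hηT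
  rw [hη0, hη1, rho] at key
  refine key.trans ?_
  have hsplit := eVariationOn.Icc_add_Icc η (s := Set.univ) (a := 0) (b := 1 / 2) (c := (1 : ℝ))
    (by norm_num) (by norm_num) (Set.mem_univ _)
  simp only [Set.univ_inter] at hsplit
  rw [← hsplit]
  gcongr
  · rw [eVariationOn.congr (f := η) (g := γ ∘ fun t => 2 * t)
      (s := Set.Icc 0 (1 / 2)) fun t ht => if_pos ht.2]
    refine eVariationOn.comp_le_of_monotoneOn γ _ (fun s _ t _ h => by linarith) ?_
    rintro t ⟨h0, h1⟩
    exact ⟨by linarith, by linarith⟩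
  · rw [eVariationOn.congr (f := η) (g := γ' ∘ fun t => 2 * t - 1) fun t ht => ?_]
    · refine eVariationOn.comp_le_of_monotoneOn γ' _ (fun s _ t _ h => by linarith) ?_
      rintro t ⟨h0, h1⟩
      exact ⟨by linarith, by linarith⟩
    · rcases ht.1.lt_or_eq with h | rfl
      · exact if_neg h.not_ge
      · norm_num [η, h1, h0']

theorem rho_le_of_mem_brokenLinePairs {T s t : Set (EuclideanSpace ℝ (Fin 3))}
    {x y : EuclideanSpace ℝ (Fin 3)} {R : ℝ} (h : (x, y) ∈ brokenLinePairs s t R)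
    (hs : ∀ q ∈ s, segment ℝ x q ⊆ T) (hst : ∀ q ∈ s, ∀ r ∈ t, segment ℝ q r ⊆ T)
    (ht : ∀ r ∈ t, segment ℝ r y ⊆ T) : rho T x y ≤ ENNReal.ofReal R := by
  obtain ⟨q, hq, r, hr, h⟩ := h
  calc rho T x y ≤ rho T x q + rho T q r + rho T r y :=
        (rho_triangle T x r y).trans (add_le_add_left (rho_triangle T x q r) _)
    _ ≤ edist x q + edist q r + edist r y := by
        gcongr
        exacts [rho_le_edist_of_segment_subset (hs q hq),
          rho_le_edist_of_segment_subset (hst q hq r hr), rho_le_edist_of_segment_subset (ht r hr)]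
    _ = ENNReal.ofReal (‖x - q‖ + ‖q - r‖ + ‖r - y‖) := by
        rw [ENNReal.ofReal_add (by positivity) (by positivity),
          ENNReal.ofReal_add (by positivity) (by positivity), edist_dist, edist_dist, edist_dist,
          dist_eq_norm, dist_eq_norm, dist_eq_norm]
    _ ≤ ENNReal.ofReal R := ENNReal.ofReal_le_ofReal h

theorem rho_le_of_mem_faces {T : Set (EuclideanSpace ℝ (Fin 3))}
    {a b c d x y : EuclideanSpace ℝ (Fin 3)} {δ : ℝ} (hab : ‖a - b‖ ≤ δ) (hac : ‖a - c‖ ≤ δ)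
    (had : ‖a - d‖ ≤ δ) (hbc : ‖b - c‖ ≤ δ) (hbd : ‖b - d‖ ≤ δ) (hcd : ‖c - d‖ ≤ δ)
    (habc : convexHull ℝ {a, b, c} ⊆ T) (habd : convexHull ℝ {a, b, d} ⊆ T)
    (hacd : convexHull ℝ {a, c, d} ⊆ T) (hbcd : convexHull ℝ {b, c, d} ⊆ T)
    (hx : x ∈ convexHull ℝ {a, b, c}) (hy : y ∈ convexHull ℝ {a, b, d}) :
    rho T x y ≤ ENNReal.ofReal (2 / √3 * δ) := by
  have hseg : ∀ {s : Set (EuclideanSpace ℝ (Fin 3))} {p q}, convexHull ℝ s ⊆ T →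
      p ∈ convexHull ℝ s → q ∈ convexHull ℝ s → segment ℝ p q ⊆ T := fun hs hp hq =>
    ((convex_convexHull ℝ _).segment_subset hp hq).trans hs
  have hedge : ∀ {s : Set (EuclideanSpace ℝ (Fin 3))} {p q r}, p ∈ s → q ∈ s →
      r ∈ segment ℝ p q → r ∈ convexHull ℝ s := fun hp hq hr =>
    segment_subset_convexHull hp hq hr
  rcases mem_brokenLinePairs_of_faces hab hac had hbc hbd hcd hx hy with h | h | h
  · refine rho_le_of_mem_brokenLinePairs h
      (fun q hq => hseg habc hx (hedge ?_ ?_ hq))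
      (fun q hq r hr => hseg habc (hedge ?_ ?_ hq) (hedge ?_ ?_ hr))
      (fun r hr => hseg habd (hedge ?_ ?_ hr) hy) <;> simp
  · refine rho_le_of_mem_brokenLinePairs h
      (fun q hq => hseg habc hx (hedge ?_ ?_ hq))
      (fun q hq r hr => hseg hacd (hedge ?_ ?_ hq) (hedge ?_ ?_ hr))
      (fun r hr => hseg habd (hedge ?_ ?_ hr) hy) <;> simp
  · refine rho_le_of_mem_brokenLinePairs h
      (fun q hq => hseg habc hx (hedge ?_ ?_ hq))
      (fun q hq r hr => hseg hbcd (hedge ?_ ?_ hq) (hedge ?_ ?_ hr))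
      (fun r hr => hseg habd (hedge ?_ ?_ hr) hy) <;> simp

/-- The boundary of a simplex consists of the points with nonnegative barycentric coordinates, at
least one of which vanishes. -/
theorem AffineBasis.mem_frontier_convexHull_iff {ι E : Type*} [Finite ι] [NormedAddCommGroup E]
    [NormedSpace ℝ E] (b : AffineBasis ι ℝ E) {x : E} :
    x ∈ frontier (convexHull ℝ (Set.range b)) ↔
      (∀ i, 0 ≤ b.coord i x) ∧ ∃ i, b.coord i x = 0 := by
  have hclosed : IsClosed (convexHull ℝ (Set.range b)) :=
    (Set.finite_range b).isClosed_convexHull (𝕜 := ℝ)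
  rw [hclosed.frontier_eq, b.interior_convexHull, b.convexHull_eq_nonneg_coord]
  simp only [Set.mem_sdiff, Set.mem_ofPred_eq, not_forall, not_lt]
  exact and_congr_right fun h => exists_congr fun i =>
    ⟨fun hi => le_antisymm hi (h i), fun hi => hi.le⟩

theorem AffineBasis.convexHull_subset_frontier {ι E : Type*} [Finite ι] [NormedAddCommGroup E]
    [NormedSpace ℝ E] (b : AffineBasis ι ℝ E) {s : Set E} (hs : s ⊆ Set.range b) (i : ι)
    (hi : b i ∉ s) : convexHull ℝ s ⊆ frontier (convexHull ℝ (Set.range b)) := by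
  intro x hx
  refine b.mem_frontier_convexHull_iff.2 ⟨?_, i, ?_⟩
  · have := convexHull_mono hs hx
    rwa [b.convexHull_eq_nonneg_coord] at this
  · have hsub : s ⊆ b.coord i ⁻¹' {0} := by
      intro p hp
      obtain ⟨j, rfl⟩ := hs hp
      exact b.coord_apply_ne fun h => hi (h ▸ hp)
    exact convexHull_min hsub ((convex_singleton 0).affine_preimage _) hx

theorem mem_convexHull_triple_of_combination {F : Type*} [AddCommGroup F] [Module ℝ F]
    {a b c : F} {r s t : ℝ} (hr : 0 ≤ r) (hs : 0 ≤ s) (ht : 0 ≤ t) (h : r + s + t = 1) :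
    r • a + s • b + t • c ∈ convexHull ℝ {a, b, c} := by
  have hsub := subset_convexHull ℝ ({a, b, c} : Set F)
  have := (convex_convexHull ℝ ({a, b, c} : Set F)).sum_mem (t := Finset.univ)
    (w := ![r, s, t]) (z := ![a, b, c])
    (fun i _ => by fin_cases i <;> assumption) (by simpa [Fin.sum_univ_three] using h)
    (fun i _ => by fin_cases i <;> exact hsub (by simp))
  simpa [Fin.sum_univ_three] using this

/-- The boundary of a tetrahedron is the union of its four faces. -/
theorem frontier_tetrahedron_eq {a b c d : EuclideanSpace ℝ (Fin 3)}
    (hind : AffineIndependent ℝ ![a, b, c, d]) :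
    frontier (convexHull ℝ ({a, b, c, d} : Set (EuclideanSpace ℝ (Fin 3)))) =
      convexHull ℝ {a, b, c} ∪ convexHull ℝ {a, b, d} ∪ convexHull ℝ {a, c, d} ∪
        convexHull ℝ {b, c, d} := by
  let B : AffineBasis (Fin 4) ℝ (EuclideanSpace ℝ (Fin 3)) :=
    ⟨![a, b, c, d], hind, hind.affineSpan_eq_top_iff_card_eq_finrank_add_one.2 (by simp)⟩
  have hB : (B : Fin 4 → EuclideanSpace ℝ (Fin 3)) = ![a, b, c, d] := rfl
  have hrange : ({a, b, c, d} : Set (EuclideanSpace ℝ (Fin 3))) = Set.range B := by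
    rw [hB]
    simp only [Matrix.range_cons, Matrix.range_empty, Set.union_empty, Set.singleton_union]
  have hne : ∀ i j : Fin 4, i ≠ j → ![a, b, c, d] i ≠ ![a, b, c, d] j := fun i j h h' =>
    h (hind.injective h')
  have h01 : a ≠ b := hne 0 1 (by decide)
  have h02 : a ≠ c := hne 0 2 (by decide)
  have h03 : a ≠ d := hne 0 3 (by decide)
  have h12 : b ≠ c := hne 1 2 (by decide)
  have h13 : b ≠ d := hne 1 3 (by decide)
  have h23 : c ≠ d := hne 2 3 (by decide)
  apply Set.Subset.antisymm
  · intro x hx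
    rw [hrange, B.mem_frontier_convexHull_iff] at hx
    obtain ⟨hnn, i, hi⟩ := hx
    have hsum := B.sum_coord_apply_eq_one x
    have hx := B.linear_combination_coord_eq_self x
    rw [Fin.sum_univ_four] at hsum hx
    change B.coord 0 x • a + B.coord 1 x • b + B.coord 2 x • c + B.coord 3 x • d = x at hx
    fin_cases i
    · have hi : B.coord 0 x = 0 := hi
      rw [hi, zero_smul, zero_add] at hx
      refine Or.inr (hx ▸ mem_convexHull_triple_of_combination (hnn 1) (hnn 2) (hnn 3) ?_)
      linarith
    · have hi : B.coord 1 x = 0 := hi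
      rw [hi, zero_smul, add_zero] at hx
      refine Or.inl (Or.inr
        (hx ▸ mem_convexHull_triple_of_combination (hnn 0) (hnn 2) (hnn 3) ?_))
      linarith
    · have hi : B.coord 2 x = 0 := hi
      rw [hi, zero_smul, add_zero] at hx
      refine Or.inl (Or.inl (Or.inr
        (hx ▸ mem_convexHull_triple_of_combination (hnn 0) (hnn 1) (hnn 3) ?_)))
      linarith
    · have hi : B.coord 3 x = 0 := hi
      rw [hi, zero_smul, add_zero] at hx
      refine Or.inl (Or.inl (Or.inl
        (hx ▸ mem_convexHull_triple_of_combination (hnn 0) (hnn 1) (hnn 2) ?_)))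
      linarith
  · rw [hrange]
    have hsub : ∀ {p q r : EuclideanSpace ℝ (Fin 3)}, p ∈ Set.range B → q ∈ Set.range B →
        r ∈ Set.range B → {p, q, r} ⊆ Set.range B := fun hp hq hr =>
      Set.insert_subset hp (Set.insert_subset hq (Set.singleton_subset_iff.2 hr))
    have m0 : a ∈ Set.range B := ⟨0, rfl⟩
    have m1 : b ∈ Set.range B := ⟨1, rfl⟩
    have m2 : c ∈ Set.range B := ⟨2, rfl⟩
    have m3 : d ∈ Set.range B := ⟨3, rfl⟩
    refine Set.union_subset (Set.union_subset (Set.union_subset ?_ ?_) ?_) ?_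
    · exact B.convexHull_subset_frontier (hsub m0 m1 m2) 3 (by
        simp [hB, h03.symm, h13.symm, h23.symm])
    · exact B.convexHull_subset_frontier (hsub m0 m1 m3) 2 (by
        simp [hB, h02.symm, h12.symm, h23])
    · exact B.convexHull_subset_frontier (hsub m0 m2 m3) 1 (by
        simp [hB, h01.symm, h12, h13])
    · exact B.convexHull_subset_frontier (hsub m1 m2 m3) 0 (by
        simp [hB, h01, h02, h03])

theorem stmt0 (a b c d : EuclideanSpace ℝ (Fin 3))
    (hind : AffineIndependent ℝ ![a, b, c, d])
    (T : Set (EuclideanSpace ℝ (Fin 3)))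
    (hT : T = frontier (convexHull ℝ ({a, b, c, d} : Set (EuclideanSpace ℝ (Fin 3))))) :
    EMetric.diam T ≤ intrinsicDiam T ∧
      intrinsicDiam T ≤ ENNReal.ofReal (2 / Real.sqrt 3) * EMetric.diam T := by
  change Metric.ediam T ≤ intrinsicDiam T ∧
      intrinsicDiam T ≤ ENNReal.ofReal (2 / Real.sqrt 3) * Metric.ediam T
  refine ⟨Metric.ediam_le fun x hx y hy => (edist_le_rho T x y).trans ?_, ?_⟩
  · exact le_iSup₂_of_le x hx (le_iSup₂_of_le y hy le_rfl)
  have hbdd : Bornology.IsBounded T := by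
    have hK : IsCompact (convexHull ℝ ({a, b, c, d} : Set (EuclideanSpace ℝ (Fin 3)))) :=
      (Set.toFinite _).isCompact_convexHull (𝕜 := ℝ)
    rw [hT]
    exact hK.isBounded.subset hK.isClosed.frontier_subset
  rw [frontier_tetrahedron_eq hind] at hT
  have habc : convexHull ℝ {a, b, c} ⊆ T := fun x hx => hT ▸ Or.inl (Or.inl (Or.inl hx))
  have habd : convexHull ℝ {a, b, d} ⊆ T := fun x hx => hT ▸ Or.inl (Or.inl (Or.inr hx))
  have hacd : convexHull ℝ {a, c, d} ⊆ T := fun x hx => hT ▸ Or.inl (Or.inr hx)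
  have hbcd : convexHull ℝ {b, c, d} ⊆ T := fun x hx => hT ▸ Or.inr hx
  set δ := Metric.diam T with hδ
  have hδ' : ENNReal.ofReal (2 / √3) * Metric.ediam T = ENNReal.ofReal (2 / √3 * δ) := by
    rw [ENNReal.ofReal_mul (by positivity), hδ, Metric.diam,
      ENNReal.ofReal_toReal hbdd.ediam_ne_top]
  have hdist : ∀ p ∈ T, ∀ q ∈ T, ‖p - q‖ ≤ δ := fun p hp q hq => by
    rw [← dist_eq_norm]
    exact Metric.dist_le_diam_of_mem hbdd hp hq
  have ha : a ∈ T := habc (subset_convexHull ℝ _ (by simp))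
  have hb : b ∈ T := habc (subset_convexHull ℝ _ (by simp))
  have hc : c ∈ T := habc (subset_convexHull ℝ _ (by simp))
  have hd : d ∈ T := habd (subset_convexHull ℝ _ (by simp))
  have hface : ∀ {s : Set (EuclideanSpace ℝ (Fin 3))}, convexHull ℝ s ⊆ T →
      ∀ x ∈ convexHull ℝ s, ∀ y ∈ convexHull ℝ s, rho T x y ≤ ENNReal.ofReal (2 / √3 * δ) := by
    intro s hs x hx y hy
    refine (rho_le_edist_of_segment_subset
      (((convex_convexHull ℝ s).segment_subset hx hy).trans hs)).trans ?_
    rw [edist_dist, dist_eq_norm]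
    refine ENNReal.ofReal_le_ofReal ((hdist x (hs hx) y (hs hy)).trans ?_)
    refine le_mul_of_one_le_left Metric.diam_nonneg ?_
    rw [le_div_iff₀ (by positivity), one_mul, Real.sqrt_le_left (by norm_num)]
    norm_num
  have hadj : ∀ {p q r s : EuclideanSpace ℝ (Fin 3)}, p ∈ T → q ∈ T → r ∈ T → s ∈ T →
      convexHull ℝ {p, q, r} ⊆ T → convexHull ℝ {p, q, s} ⊆ T → convexHull ℝ {p, r, s} ⊆ T →
      convexHull ℝ {q, r, s} ⊆ T → ∀ x ∈ convexHull ℝ {p, q, r}, ∀ y ∈ convexHull ℝ {p, q, s},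
      rho T x y ≤ ENNReal.ofReal (2 / √3 * δ) := by
    intro p q r s hp hq hr hs h1 h2 h3 h4 x hx y hy
    exact rho_le_of_mem_faces (hdist p hp q hq) (hdist p hp r hr) (hdist p hp s hs)
      (hdist q hq r hr) (hdist q hq s hs) (hdist r hr s hs) h1 h2 h3 h4 hx hy
  rw [hδ']
  refine iSup₂_le fun x hx => iSup₂_le fun y hy => ?_
  have hswap : ∀ p q r : EuclideanSpace ℝ (Fin 3), ({p, q, r} : Set _) = {q, p, r} :=
    fun p q r => Set.insert_comm p q {r}
  have hswap' : ∀ p q r : EuclideanSpace ℝ (Fin 3), ({p, q, r} : Set _) = {p, r, q} :=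
    fun p q r => by rw [Set.pair_comm]
  have hrot : ∀ p q r : EuclideanSpace ℝ (Fin 3), ({p, q, r} : Set _) = {q, r, p} :=
    fun p q r => by rw [hswap, hswap']
  rw [hT] at hx hy
  rcases hx with ((hx | hx) | hx) | hx <;> rcases hy with ((hy | hy) | hy) | hy
  · exact hface habc x hx y hy
  · exact hadj ha hb hc hd habc habd hacd hbcd x hx y hy
  · exact hadj ha hc hb hd (hswap' a b c ▸ habc) hacd habd (hswap b c d ▸ hbcd) x
      (hswap' a b c ▸ hx) y hy
  · exact hadj hb hc ha hd (hrot a b c ▸ habc) hbcd (hswap a b d ▸ habd) (hswap a c d ▸ hacd) x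
      (hrot a b c ▸ hx) y hy
  · exact hadj ha hb hd hc habd habc (hswap' a c d ▸ hacd) (hswap' b c d ▸ hbcd) x hx y hy
  · exact hface habd x hx y hy
  · exact hadj ha hd hb hc (hswap' a b d ▸ habd) (hswap' a c d ▸ hacd) habc
      (hrot d b c ▸ hbcd) x (hswap' a b d ▸ hx) y (hswap' a c d ▸ hy)
  · exact hadj hb hd ha hc (hrot a b d ▸ habd) (hswap' b c d ▸ hbcd) (hswap a b c ▸ habc)
      (hrot d a c ▸ hacd) x (hrot a b d ▸ hx) y (hswap' b c d ▸ hy)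
  · exact hadj ha hc hd hb hacd (hswap' a b c ▸ habc) (hswap' a b d ▸ habd)
      (hrot b c d ▸ hbcd) x hx y (hswap' a b c ▸ hy)
  · exact hadj ha hd hc hb (hswap' a c d ▸ hacd) (hswap' a b d ▸ habd) (hswap' a b c ▸ habc)
      (by rwa [hswap' d c b, hrot d b c]) x (hswap' a c d ▸ hx) y (hswap' a b d ▸ hy)
  · exact hface hacd x hx y hy
  · exact hadj hc hd ha hb (hrot a c d ▸ hacd) (hrot b c d ▸ hbcd) (hrot c a b ▸ habc)
      (hrot d a b ▸ habd) x (hrot a c d ▸ hx) y (hrot b c d ▸ hy)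
  · exact hadj hb hc hd ha hbcd (hrot a b c ▸ habc) (hrot a b d ▸ habd) (hrot a c d ▸ hacd) x hx y
      (hrot a b c ▸ hy)
  · exact hadj hb hd hc ha (hswap' b c d ▸ hbcd) (hrot a b d ▸ habd) (hrot a b c ▸ habc)
      (by rwa [hswap d c a, ← hrot a c d]) x (hswap' b c d ▸ hx) y (hrot a b d ▸ hy)
  · exact hadj hc hd hb ha (hrot b c d ▸ hbcd) (hrot a c d ▸ hacd)
      (hrot a c b ▸ hswap' a b c ▸ habc) (hrot a d b ▸ hswap' a b d ▸ habd) x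
      (hrot b c d ▸ hx) y (hrot a c d ▸ hy)
  · exact hface hbcd x hx y hy
end

section
/- For any tetrahedron, the intrinsic radius is at most the extrinsic diameter: Rad(T) ≤ diam(T). -/
open scoped ENNReal

/-- Intrinsic radius. -/
noncomputable def intrinsicRad (T : Set (EuclideanSpace ℝ (Fin 3))) : ℝ≥0∞ :=
  ⨅ x ∈ T, ⨆ y ∈ T, rho T x y

/-- Extrinsic radius. -/
noncomputable def extrinsicRad (T : Set (EuclideanSpace ℝ (Fin 3))) : ℝ≥0∞ :=
  ⨅ x ∈ T, ⨆ y ∈ T, edist x y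

local notation "E3" => EuclideanSpace ℝ (Fin 3)

/-- A path made of two segments in `T` bounds the intrinsic distance. -/
theorem rho_le_of_segments {T : Set E3} {x p y : E3}
    (hxp : segment ℝ x p ⊆ T) (hpy : segment ℝ p y ⊆ T) :
    rho T x y ≤ ENNReal.ofReal (dist x p + dist p y) := by
  have hvar : ∀ (u v : E3) (φ : ℝ → ℝ) (s t : ℝ), Monotone φ → s ≤ t → φ s = 0 → φ t = 1 →
      eVariationOn (fun r => AffineMap.lineMap u v (φ r)) (Set.Icc s t) ≤ edist u v := by
    intro u v φ s t hφ hst hs ht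
    have hL : LipschitzWith (nndist u v) (AffineMap.lineMap u v : ℝ → E3) :=
      lipschitzWith_lineMap u v
    refine ((hL.lipschitzOnWith (s := Set.univ)).comp_eVariationOn_le
      (fun _ _ => Set.mem_univ _)).trans ?_
    have := (hφ.monotoneOn (Set.Icc s t)).eVariationOn_eq
      (Set.left_mem_Icc.2 hst) (Set.right_mem_Icc.2 hst)
    rw [Set.inter_self, hs, ht, sub_zero, ENNReal.ofReal_one] at this
    rw [edist_nndist]
    exact (mul_le_mul_right this.le _).trans (mul_one _).le
  let φ : ℝ → ℝ := fun t => min (2 * t) 1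
  let ψ : ℝ → ℝ := fun t => max (2 * t - 1) 0
  have hφ : Monotone φ := fun s t h => min_le_min (by linarith) le_rfl
  have hψ : Monotone ψ := fun s t h => max_le_max (by linarith) le_rfl
  let γ : ℝ → E3 := fun t =>
    AffineMap.lineMap x p (φ t) + (AffineMap.lineMap p y (ψ t) - p)
  have hγ₁ : ∀ t ≤ (1 / 2 : ℝ), γ t = AffineMap.lineMap x p (φ t) := by
    intro t ht
    have : ψ t = 0 := max_eq_right (by linarith)
    simp [γ, this]
  have hγ₂ : ∀ t ≥ (1 / 2 : ℝ), γ t = AffineMap.lineMap p y (ψ t) := by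
    intro t ht
    have : φ t = 1 := min_eq_right (by linarith)
    simp [γ, this]
  have hcont : Continuous γ := by
    simp only [γ, φ, ψ, AffineMap.lineMap_apply]
    fun_prop
  refine iInf_le_of_le γ <| iInf_le_of_le hcont <| iInf_le_of_le ?_ <| iInf_le_of_le ?_ <|
    iInf_le_of_le ?_ ?_
  · rw [hγ₁ 0 (by norm_num)]; simp [φ]
  · rw [hγ₂ 1 (by norm_num)]; norm_num [ψ]
  · rintro t ⟨h0, h1⟩
    rcases le_total t (1 / 2) with h | h
    · rw [hγ₁ t h]
      refine hxp (segment_eq_image_lineMap ℝ x p ▸ Set.mem_image_of_mem _ ⟨?_, min_le_right _ _⟩)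
      exact le_min (by linarith) zero_le_one
    · rw [hγ₂ t h]
      refine hpy (segment_eq_image_lineMap ℝ p y ▸ Set.mem_image_of_mem _ ⟨le_max_right _ _, ?_⟩)
      exact max_le (by linarith) zero_le_one
  · have hsplit := eVariationOn.Icc_add_Icc γ (s := Set.univ) (a := 0) (b := 1 / 2) (c := 1)
      (by norm_num) (by norm_num) (Set.mem_univ _)
    simp only [Set.univ_inter] at hsplit
    rw [← hsplit, ENNReal.ofReal_add dist_nonneg dist_nonneg, ← edist_dist, ← edist_dist]
    refine add_le_add ?_ ?_
    · rw [eVariationOn.congr fun t ht => hγ₁ t ht.2]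
      exact hvar x p φ _ _ hφ (by norm_num) (by simp [φ]) (by simp [φ])
    · rw [eVariationOn.congr fun t ht => hγ₂ t ht.1]
      exact hvar p y ψ _ _ hψ (by norm_num) (by simp [ψ]) (by norm_num [ψ])

/-- A point of the triangle `acd` lying on the `c` side of the median through `a` is reached from
the midpoint of `ab` by crossing the edge `ac`. -/
theorem rho_midpoint_le_of_ge {T F G : Set E3} (hF : Convex ℝ F) (hG : Convex ℝ G)
    (hFT : F ⊆ T) (hGT : G ⊆ T) {a b c d : E3} (haF : a ∈ F) (hbF : b ∈ F) (hcF : c ∈ F)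
    (haG : a ∈ G) (hcG : c ∈ G) (hdG : d ∈ G) {D : ℝ} (hab : dist a b ≤ D) (hac : dist a c ≤ D)
    (had : dist a d ≤ D) (hbc : dist b c ≤ D) {α β δ : ℝ} (hα : 0 ≤ α) (hδ : 0 ≤ δ)
    (hβ : δ ≤ β) (hsum : α + β + δ = 1) :
    rho T (midpoint ℝ a b) (α • a + β • c + δ • d) ≤ ENNReal.ofReal D := by
  have hmid : midpoint ℝ a b = (1 / 2 : ℝ) • a + (1 / 2 : ℝ) • b := by
    rw [midpoint_eq_smul_add, smul_add]; norm_num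
  have hβ0 : 0 ≤ β := hδ.trans hβ
  have hpF : (α + δ) • a + β • c ∈ F := hF haF hcF (by positivity) hβ0 (by linarith)
  have hpG : (α + δ) • a + β • c ∈ G := hG haG hcG (by positivity) hβ0 (by linarith)
  have hyG : α • a + β • c + δ • d ∈ G := by
    have := hG.sum_mem (t := Finset.univ) (w := ![α, β, δ]) (z := ![a, c, d])
      (by intro i _; fin_cases i <;> simp [hα, hβ0, hδ])
      (by simp [Fin.sum_univ_three, hsum])
      (by intro i _; fin_cases i <;> simp [haG, hcG, hdG])
    simpa [Fin.sum_univ_three] using this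
  have hmF : midpoint ℝ a b ∈ F := hF.midpoint_mem haF hbF
  refine (rho_le_of_segments ((hF.segment_subset hmF hpF).trans hFT)
    ((hG.segment_subset hpG hyG).trans hGT)).trans (ENNReal.ofReal_le_ofReal ?_)
  have h₁ : dist (midpoint ℝ a b) ((α + δ) • a + β • c) ≤ (α / 2 + δ + (β - δ)) * D := by
    obtain rfl : α = 1 - β - δ := by linarith
    have e : midpoint ℝ a b - ((1 - β - δ + δ) • a + β • c)
        = ((1 - β - δ) / 2) • (b - a) + ((β - δ) / 2) • (a - c) + ((β + δ) / 2) • (b - c) := by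
      rw [hmid]; module
    rw [dist_eq_norm, e]
    refine (norm_add₃_le).trans ?_
    rw [norm_smul_of_nonneg (by linarith), norm_smul_of_nonneg (by linarith),
      norm_smul_of_nonneg (by linarith), ← dist_eq_norm, ← dist_eq_norm, ← dist_eq_norm,
      dist_comm b a]
    nlinarith [mul_le_mul_of_nonneg_left hab (show 0 ≤ (1 - β - δ) / 2 by linarith),
      mul_le_mul_of_nonneg_left hac (show 0 ≤ (β - δ) / 2 by linarith),
      mul_le_mul_of_nonneg_left hbc (show 0 ≤ (β + δ) / 2 by linarith)]
  have h₂ : dist ((α + δ) • a + β • c) (α • a + β • c + δ • d) ≤ δ * D := by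
    have e : (α + δ) • a + β • c - (α • a + β • c + δ • d) = δ • (a - d) := by module
    rw [dist_eq_norm, e, norm_smul_of_nonneg hδ, ← dist_eq_norm]
    exact mul_le_mul_of_nonneg_left had hδ
  have hD : 0 ≤ D := dist_nonneg.trans hab
  nlinarith [mul_nonneg hα hD]

theorem rho_midpoint_le {T F F' G : Set E3} (hF : Convex ℝ F) (hF' : Convex ℝ F')
    (hG : Convex ℝ G) (hFT : F ⊆ T) (hFT' : F' ⊆ T) (hGT : G ⊆ T) {a b c d : E3}
    (haF : a ∈ F) (hbF : b ∈ F) (hcF : c ∈ F) (haF' : a ∈ F') (hbF' : b ∈ F') (hdF' : d ∈ F')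
    (haG : a ∈ G) (hcG : c ∈ G) (hdG : d ∈ G) {D : ℝ} (hab : dist a b ≤ D) (hac : dist a c ≤ D)
    (had : dist a d ≤ D) (hbc : dist b c ≤ D) (hbd : dist b d ≤ D) {α β δ : ℝ} (hα : 0 ≤ α)
    (hβ : 0 ≤ β) (hδ : 0 ≤ δ) (hsum : α + β + δ = 1) :
    rho T (midpoint ℝ a b) (α • a + β • c + δ • d) ≤ ENNReal.ofReal D := by
  rcases le_total δ β with h | h
  · exact rho_midpoint_le_of_ge hF hG hFT hGT haF hbF hcF haG hcG hdG hab hac had hbc hα hδ h hsum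
  · rw [add_right_comm]
    exact rho_midpoint_le_of_ge hF' hG hFT' hGT haF' hbF' hdF' haG hdG hcG hab had hac hbd hα hβ h
      (by linarith)

/-- The facet of a simplex opposite to the vertex with index `i`. -/
def facet (B : AffineBasis (Fin 4) ℝ E3) (i : Fin 4) : Set E3 :=
  {x | (∀ j, 0 ≤ B.coord j x) ∧ B.coord i x = 0}

theorem convex_facet (B : AffineBasis (Fin 4) ℝ E3) (i : Fin 4) : Convex ℝ (facet B i) := by
  rintro x ⟨hx, hxi⟩ y ⟨hy, hyi⟩ s t hs ht hst
  have h : ∀ j, B.coord j (s • x + t • y) = s * B.coord j x + t * B.coord j y := fun j => by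
    rw [Convex.combo_affine_apply hst, smul_eq_mul, smul_eq_mul]
  refine ⟨fun j => ?_, by rw [h, hxi, hyi]; simp⟩
  rw [h]
  exact add_nonneg (mul_nonneg hs (hx j)) (mul_nonneg ht (hy j))

theorem vertex_mem_facet (B : AffineBasis (Fin 4) ℝ E3) {i j : Fin 4} (h : i ≠ j) :
    B j ∈ facet B i :=
  ⟨fun k => by rw [B.coord_apply]; split_ifs <;> norm_num, B.coord_apply_ne h⟩

theorem mem_frontier_iff_exists_facet (B : AffineBasis (Fin 4) ℝ E3) (x : E3) :
    x ∈ frontier (convexHull ℝ (Set.range B)) ↔ ∃ i, x ∈ facet B i := by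
  rw [((Set.finite_range B).isCompact_convexHull ℝ).isClosed.frontier_eq, B.interior_convexHull,
    B.convexHull_eq_nonneg_coord]
  simp only [facet, Set.mem_sdiff, Set.mem_ofPred_eq, not_forall, not_lt]
  constructor
  · rintro ⟨h, i, hi⟩
    exact ⟨i, h, le_antisymm hi (h i)⟩
  · rintro ⟨i, h, hi⟩
    exact ⟨h, i, hi.le⟩

theorem stmt1 (a b c d : EuclideanSpace ℝ (Fin 3))
    (hind : AffineIndependent ℝ ![a, b, c, d])
    (T : Set (EuclideanSpace ℝ (Fin 3)))
    (hT : T = frontier (convexHull ℝ ({a, b, c, d} : Set (EuclideanSpace ℝ (Fin 3))))) :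
    intrinsicRad T ≤ EMetric.diam T := by
  have htop : affineSpan ℝ (Set.range ![a, b, c, d]) = ⊤ :=
    hind.affineSpan_eq_top_iff_card_eq_finrank_add_one.2 (by simp)
  let B : AffineBasis (Fin 4) ℝ (EuclideanSpace ℝ (Fin 3)) := ⟨![a, b, c, d], hind, htop⟩
  have hB : Set.range B = {a, b, c, d} := by
    change Set.range ![a, b, c, d] = _
    ext x; simp [eq_comm (a := x)]; tauto
  have hmem : ∀ x, x ∈ T ↔ ∃ i, x ∈ facet B i := fun x => by
    rw [hT, ← hB, mem_frontier_iff_exists_facet]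
  have hsub : ∀ i, facet B i ⊆ T := fun i x hx => (hmem x).2 ⟨i, hx⟩
  have hbdd : Bornology.IsBounded T := by
    have hK := (Set.finite_range B).isCompact_convexHull ℝ
    rw [hT, ← hB]
    exact hK.isBounded.subset hK.isClosed.frontier_subset
  have hv : ∀ {i j : Fin 4}, i ≠ j → B j ∈ facet B i := vertex_mem_facet B
  have hvT : ∀ j, B j ∈ T := fun j =>
    hsub (j + 1) (hv (by fin_cases j <;> decide))
  have hd : ∀ {u v}, u ∈ T → v ∈ T → dist u v ≤ Metric.diam T :=
    fun hu hv => Metric.dist_le_diam_of_mem hbdd hu hv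
  have hm : ∀ {i}, i ≠ 0 → i ≠ 1 → midpoint ℝ (B 0) (B 1) ∈ facet B i := fun h₀ h₁ =>
    (convex_facet B _).midpoint_mem (hv h₀) (hv h₁)
  have hself : ∀ {i y}, i ≠ 0 → i ≠ 1 → y ∈ facet B i →
      rho T (midpoint ℝ (B 0) (B 1)) y ≤ ENNReal.ofReal (Metric.diam T) := by
    intro i y h₀ h₁ hy
    have hs := ((convex_facet B i).segment_subset (hm h₀ h₁) hy).trans (hsub i)
    refine (rho_le_of_segments (p := y) hs ?_).trans (ENNReal.ofReal_le_ofReal ?_)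
    · simpa using hsub i hy
    · simpa using hd (hsub i (hm h₀ h₁)) (hsub i hy)
  refine (iInf₂_le (midpoint ℝ (B 0) (B 1)) (hsub 2 (hm (by decide) (by decide)))).trans
    (iSup₂_le fun y hy => le_trans ?_ (ENNReal.ofReal_toReal_le (a := Metric.ediam T)))
  obtain ⟨i, hi⟩ := (hmem y).1 hy
  have hsum := B.sum_coord_apply_eq_one y
  have hcomb := B.linear_combination_coord_eq_self y
  rw [Fin.sum_univ_four] at hsum hcomb
  have hF := convex_facet B
  fin_cases i
  · have h0 : B.coord 0 y = 0 := hi.2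
    rw [h0, zero_add] at hsum
    rw [h0, zero_smul, zero_add] at hcomb
    rw [← hcomb, midpoint_comm]
    exact rho_midpoint_le (hF 3) (hF 2) (hF 0) (hsub 3) (hsub 2) (hsub 0)
      (hv (by decide)) (hv (by decide)) (hv (by decide)) (hv (by decide)) (hv (by decide))
      (hv (by decide)) (hv (by decide)) (hv (by decide)) (hv (by decide))
      (hd (hvT _) (hvT _)) (hd (hvT _) (hvT _)) (hd (hvT _) (hvT _)) (hd (hvT _) (hvT _))
      (hd (hvT _) (hvT _)) (hi.1 _) (hi.1 _) (hi.1 _) hsum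
  · have h1 : B.coord 1 y = 0 := hi.2
    rw [h1, add_zero] at hsum
    rw [h1, zero_smul, add_zero] at hcomb
    rw [← hcomb]
    exact rho_midpoint_le (hF 3) (hF 2) (hF 1) (hsub 3) (hsub 2) (hsub 1)
      (hv (by decide)) (hv (by decide)) (hv (by decide)) (hv (by decide)) (hv (by decide))
      (hv (by decide)) (hv (by decide)) (hv (by decide)) (hv (by decide))
      (hd (hvT _) (hvT _)) (hd (hvT _) (hvT _)) (hd (hvT _) (hvT _)) (hd (hvT _) (hvT _))
      (hd (hvT _) (hvT _)) (hi.1 _) (hi.1 _) (hi.1 _) hsum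
  · exact hself (by decide) (by decide) hi
  · exact hself (by decide) (by decide) hi
end

section
/- For any convex polyhedron, the extrinsic radius is strictly smaller than the extrinsic diameter, which is at most twice the extrinsic radius: rad(P) < diam(P) ≤ 2 · rad(P). -/
open scoped ENNReal

open Metric Set

/-- The frontier of a compact set with nonempty interior is infinite in dimension at least two. -/
theorem IsCompact.frontier_infinite {E : Type*} [NormedAddCommGroup E] [NormedSpace ℝ E]
    (hE : 1 < Module.rank ℝ E) {K : Set E} (hK : IsCompact K) (hint : (interior K).Nonempty) :
    (frontier K).Infinite := by
  intro hfin
  have : Nontrivial E := rank_pos_iff_nontrivial.1 (zero_lt_one.trans hE)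
  have : NoncompactSpace E := NormedSpace.noncompactSpace ℝ E
  obtain ⟨z, hz⟩ : Kᶜ.Nonempty := nonempty_compl.2 hK.ne_univ
  have hdiff : frontier K = K \ interior K := hK.isClosed.frontier_eq
  obtain ⟨x, -, hx, hxK⟩ :=
    (hfin.countable.isConnected_compl_of_one_lt_rank hE).isPreconnected (interior K) Kᶜ
      isOpen_interior hK.isClosed.isOpen_compl
      (fun x hx ↦ by
        rw [hdiff] at hx
        by_cases hxK : x ∈ K
        · exact .inl (not_not.1 fun h ↦ hx ⟨hxK, h⟩)
        · exact .inr hxK)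
      (hint.mono fun x hx ↦ ⟨fun h ↦ (hdiff ▸ h).2 hx, hx⟩)
      ⟨z, fun h ↦ hz (hK.isClosed.frontier_subset h), hz⟩
  exact hxK (interior_subset hx)

/-- A compact convex set has the same diameter as its frontier. -/
theorem Convex.ediam_frontier {E : Type*} [NormedAddCommGroup E] [NormedSpace ℝ E] [Nontrivial E]
    {K : Set E} (hconv : Convex ℝ K) (hK : IsCompact K) : ediam (frontier K) = ediam K := by
  have hsub : K.extremePoints ℝ ⊆ frontier K := fun x hx ↦ by
    rw [hK.isClosed.frontier_eq]
    exact ⟨hx.1, fun h ↦ (disjoint_interior_extremePoints K).ne_of_mem h hx rfl⟩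
  refine (ediam_mono hK.isClosed.frontier_subset).antisymm ?_
  calc ediam K = ediam (K.extremePoints ℝ) := by
        rw [← convexHull_ediam (K.extremePoints ℝ), ← ediam_closure (convexHull ℝ _),
          closure_convexHull_extremePoints hK hconv]
    _ ≤ ediam (frontier K) := ediam_mono hsub

/-- A point of a bounded set in a strictly convex space which realizes the diameter is extreme. -/
theorem mem_extremePoints_of_edist_eq_ediam {E : Type*} [NormedAddCommGroup E] [NormedSpace ℝ E]
    [StrictConvexSpace ℝ E] {K : Set E} (hK : Bornology.IsBounded K) {x y : E} (hx : x ∈ K)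
    (hy : y ∈ K) (hxy : edist x y = ediam K) : x ∈ K.extremePoints ℝ := by
  refine mem_extremePoints_iff_left.2 ⟨hx, fun a ha b hb hxab ↦ ?_⟩
  have hdist : dist x y = diam K := by rw [dist_edist, hxy, diam]
  by_contra hne
  have hab : a ≠ b := by
    rintro rfl
    rw [openSegment_same] at hxab
    exact hne hxab.symm
  have hlt : dist x y < diam K :=
    openSegment_subset_ball_of_ne (mem_closedBall.2 (dist_le_diam_of_mem hK ha hy))
      (mem_closedBall.2 (dist_le_diam_of_mem hK hb hy)) hab hxab
  exact hlt.ne hdist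

theorem extrinsicRad_lt_ediam {T : Set (EuclideanSpace ℝ (Fin 3))} (hT : IsCompact T)
    {x : EuclideanSpace ℝ (Fin 3)} (hx : x ∈ T) (h : ∀ y ∈ T, edist x y ≠ ediam T) :
    extrinsicRad T < ediam T := by
  obtain ⟨y, hy, hmax⟩ := hT.exists_isMaxOn ⟨x, hx⟩
    (continuous_const.edist continuous_id).continuousOn (f := fun y ↦ edist x y)
  calc extrinsicRad T ≤ ⨆ z ∈ T, edist x z := iInf₂_le x hx
    _ ≤ edist x y := iSup₂_le fun z hz ↦ hmax hz
    _ < ediam T := (edist_le_ediam_of_mem hx hy).lt_of_ne (h y hy)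

theorem ediam_le_two_mul_extrinsicRad (T : Set (EuclideanSpace ℝ (Fin 3))) :
    ediam T ≤ 2 * extrinsicRad T := by
  simp only [extrinsicRad, ENNReal.mul_iInf_of_ne two_ne_zero ENNReal.ofNat_ne_top]
  refine le_iInf₂ fun z hz ↦ ediam_le fun x hx y hy ↦ ?_
  calc edist x y ≤ edist z x + edist z y := edist_triangle_left x y z
    _ ≤ (⨆ w ∈ T, edist z w) + ⨆ w ∈ T, edist z w :=
      add_le_add (le_iSup₂_of_le x hx le_rfl) (le_iSup₂_of_le y hy le_rfl)
    _ = 2 * ⨆ w ∈ T, edist z w := (two_mul _).symm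

theorem stmt4 (V : Set (EuclideanSpace ℝ (Fin 3))) (hV : V.Finite)
    (K : Set (EuclideanSpace ℝ (Fin 3))) (hK : K = convexHull ℝ V)
    (hint : (interior K).Nonempty)
    (P : Set (EuclideanSpace ℝ (Fin 3))) (hP : P = frontier K) :
    extrinsicRad P < EMetric.diam P ∧ EMetric.diam P ≤ 2 * extrinsicRad P := by
  subst hK hP
  have hcomp : IsCompact (convexHull ℝ V) := hV.isCompact_convexHull ℝ
  have hcompF : IsCompact (frontier (convexHull ℝ V)) :=
    hcomp.of_isClosed_subset isClosed_frontier hcomp.isClosed.frontier_subset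
  have hrank : 1 < Module.rank ℝ (EuclideanSpace ℝ (Fin 3)) := by
    rw [← Module.finrank_eq_rank, finrank_euclideanSpace_fin]
    norm_num
  obtain ⟨x, hx, hxV⟩ := (hcomp.frontier_infinite hrank hint).exists_notMem_finite hV
  refine ⟨extrinsicRad_lt_ediam hcompF hx fun y hy hxy ↦ hxV ?_, ediam_le_two_mul_extrinsicRad _⟩
  rw [(convex_convexHull ℝ V).ediam_frontier hcomp] at hxy
  exact extremePoints_convexHull_subset (mem_extremePoints_of_edist_eq_ediam hcomp.isBounded
    (hcomp.isClosed.frontier_subset hx) (hcomp.isClosed.frontier_subset hy) hxy)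
end

section
/- Let P be a convex polyhedron and let x, y ∈ P be such that y is the unique farthest point of P from x (for all z ∈ P, dist x z ≤ dist x y, and dist x z = dist x y implies z = y) and dist x y = rad(P). Then x is the foot of the perpendicular from y onto a face of P; precisely, the plane through x orthogonal to y − x supports K: ⟪z − x, y − x⟫_ℝ ≥ 0 for every z ∈ K. -/
open scoped ENNReal RealInnerProductSpace

/-- Every point of a compact set has a point of the set at distance at least the radius. -/
theorem exists_extrinsicRad_le_edist {T : Set (EuclideanSpace ℝ (Fin 3))} (hT : IsCompact T)
    {x : EuclideanSpace ℝ (Fin 3)} (hx : x ∈ T) : ∃ z ∈ T, extrinsicRad T ≤ edist x z := by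
  obtain ⟨z, hz, hmax⟩ := hT.exists_isMaxOn ⟨x, hx⟩
    (continuous_const.edist continuous_id : Continuous fun z => edist x z).continuousOn
  exact ⟨z, hz, (iInf₂_le x hx).trans (iSup₂_le fun w hw => hmax hw)⟩

/-- A preconnected set meeting a set and its complement meets the frontier. -/
theorem exists_mem_frontier_of_isPreconnected {X : Type*} [TopologicalSpace X] {s K : Set X}
    (hs : IsPreconnected s) {a b : X} (ha : a ∈ s) (haK : a ∈ K) (hb : b ∈ s) (hbK : b ∉ K) :
    ∃ c ∈ s, c ∈ frontier K := by
  by_contra! h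
  have hcase : ∀ c ∈ s, c ∈ closure K → c ∈ interior K := fun c hc hcK => by
    by_contra hci
    exact h c hc ⟨hcK, hci⟩
  obtain ⟨c, -, hci, hcc⟩ := hs (interior K) (closure K)ᶜ isOpen_interior isClosed_closure.isOpen_compl
    (fun c hc => (em (c ∈ closure K)).imp (hcase c hc) id)
    ⟨a, ha, hcase a ha (subset_closure haK)⟩
    ⟨b, hb, fun hbc => hbK (interior_subset (hcase b hb hbc))⟩
  exact hcc (subset_closure (interior_subset hci))

section

variable {E : Type*} [NormedAddCommGroup E] [InnerProductSpace ℝ E]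

/-- At a boundary point of a convex set with nonempty interior there is a supporting hyperplane,
given by its normal vector. -/
theorem exists_inner_sub_nonpos_of_mem_frontier [CompleteSpace E] {K : Set E} (hK : Convex ℝ K)
    (hint : (interior K).Nonempty) {x : E} (hx : x ∈ frontier K) :
    ∃ a : E, ∀ k ∈ K, ⟪a, k - x⟫ ≤ 0 ∧ (k ∈ interior K → ⟪a, k - x⟫ < 0) := by
  obtain ⟨f, hf⟩ := geometric_hahn_banach_open_point hK.interior isOpen_interior hx.2
  refine ⟨(InnerProductSpace.toDual ℝ E).symm f, fun k hk => ⟨?_, fun hk' => ?_⟩⟩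
  · rw [InnerProductSpace.toDual_symm_apply, map_sub, sub_nonpos]
    have hsub : closure (interior K) ⊆ {k | f k ≤ f x} :=
      closure_minimal (fun k hk => (hf k hk).le) (isClosed_le f.continuous continuous_const)
    exact hsub (hK.closure_interior_eq_closure_of_nonempty_interior hint ▸ subset_closure hk)
  · rw [InnerProductSpace.toDual_symm_apply, map_sub, sub_neg]
    exact hf k hk'

/-- Two vectors which do not point in opposite directions have positive inner product with a
common vector. -/
theorem exists_inner_pos_of_inner_nonpos_of_inner_neg {a u d : E} (ha : a ≠ 0) (hu : u ≠ 0)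
    (had : ⟪a, d⟫ ≤ 0) (hud : ⟪u, d⟫ < 0) : ∃ w : E, 0 < ⟪a, w⟫ ∧ 0 < ⟪u, w⟫ := by
  have ha' : 0 < ‖a‖ := norm_pos_iff.2 ha
  have hu' : 0 < ‖u‖ := norm_pos_iff.2 hu
  set w := ‖u‖ • a + ‖a‖ • u with hw
  have hw0 : w ≠ 0 := by
    intro h
    have : ‖u‖ * ⟪a, d⟫ + ‖a‖ * ⟪u, d⟫ = 0 := by
      rw [← real_inner_smul_left, ← real_inner_smul_left, ← inner_add_left, ← hw, h,
        inner_zero_left]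
    nlinarith [mul_nonneg hu'.le (neg_nonneg.2 had), mul_pos ha' (neg_pos.2 hud)]
  have haw : ⟪a, w⟫ = ‖a‖ * (‖a‖ * ‖u‖ + ⟪a, u⟫) := by
    rw [hw, inner_add_right, inner_smul_right, inner_smul_right, real_inner_self_eq_norm_sq]
    ring
  have huw : ⟪u, w⟫ = ‖u‖ * (‖a‖ * ‖u‖ + ⟪a, u⟫) := by
    rw [hw, inner_add_right, inner_smul_right, inner_smul_right, real_inner_self_eq_norm_sq,
      real_inner_comm]
    ring
  have hpos : 0 < ‖a‖ * ‖u‖ + ⟪a, u⟫ := by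
    have h : 0 < ⟪w, w⟫ := real_inner_self_pos.2 hw0
    nth_rewrite 1 [hw] at h
    rw [inner_add_left, real_inner_smul_left, real_inner_smul_left, haw, huw] at h
    have h2 : 0 < (2 * (‖a‖ * ‖u‖)) * (‖a‖ * ‖u‖ + ⟪a, u⟫) := by linarith
    exact pos_of_mul_pos_right h2 (by positivity)
  exact ⟨w, haw ▸ mul_pos ha' hpos, huw ▸ mul_pos hu' hpos⟩

/-- If `y` is the unique farthest point of a compact set `P` from `x`, then moving `x` a little in
a direction making a uniformly acute angle with `y - x` brings all of `P` strictly closer. -/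
theorem exists_pos_forall_dist_add_smul_lt {P : Set E} (hP : IsCompact P) {x y : E}
    (hfar : ∀ z ∈ P, dist x z ≤ dist x y) (huniq : ∀ z ∈ P, dist x z = dist x y → z = y)
    {c M : ℝ} (hc : 0 < c) (hM : 0 < M) :
    ∃ t : ℝ, 0 < t ∧ t ≤ 1 ∧ ∀ v : E, ‖v‖ ≤ M → c ≤ ⟪v, y - x⟫ →
      ∀ z ∈ P, dist (x + t • v) z < dist x y := by
  set δ := c / (2 * M) with hδ
  have hδ0 : 0 < δ := by positivity
  obtain ⟨η, hη, hfar'⟩ : ∃ η > 0, ∀ z ∈ P, δ ≤ dist z y → dist x z + η ≤ dist x y := by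
    have hcomp : IsCompact (P \ Metric.ball y δ) := hP.diff Metric.isOpen_ball
    rcases (P \ Metric.ball y δ).eq_empty_or_nonempty with he | hne
    · refine ⟨1, one_pos, fun z hz hzy => ?_⟩
      have : z ∈ P \ Metric.ball y δ := ⟨hz, by simpa using hzy⟩
      simp [he] at this
    · obtain ⟨m, hm, hmax⟩ := hcomp.exists_isMaxOn hne
        (continuous_const.dist continuous_id : Continuous fun z => dist x z).continuousOn
      have hlt : dist x m < dist x y := by
        refine lt_of_le_of_ne (hfar m hm.1) fun h => hm.2 ?_
        rw [huniq m hm.1 h]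
        exact Metric.mem_ball_self hδ0
      refine ⟨dist x y - dist x m, sub_pos.2 hlt, fun z hz hzy => ?_⟩
      have : dist x z ≤ dist x m := hmax (⟨hz, by simpa using hzy⟩ : z ∈ P \ Metric.ball y δ)
      linarith
  set t := min 1 (min (η / (2 * M)) (c / (2 * M ^ 2))) with ht
  have ht0 : 0 < t := by positivity
  have htη : t * (2 * M) ≤ η :=
    (le_div_iff₀ (by positivity)).1 ((min_le_right _ _).trans (min_le_left _ _))
  have htc : t * (2 * M ^ 2) ≤ c :=
    (le_div_iff₀ (by positivity)).1 ((min_le_right _ _).trans (min_le_right _ _))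
  refine ⟨t, ht0, min_le_left _ _, fun v hvM hvc z hz => ?_⟩
  rcases le_or_gt δ (dist z y) with hzy | hzy
  · have h1 : dist (x + t • v) x ≤ t * M := by
      rw [dist_eq_norm, add_sub_cancel_left, norm_smul, Real.norm_of_nonneg ht0.le]
      gcongr
    have := dist_triangle (x + t • v) x z
    have := hfar' z hz hzy
    have := mul_pos ht0 hM
    linarith
  · have hvz : ⟪v, y - z⟫ ≤ c / 2 := by
      calc ⟪v, y - z⟫ ≤ ‖v‖ * ‖y - z‖ := real_inner_le_norm _ _
        _ ≤ M * δ := by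
          gcongr
          rw [← dist_eq_norm, dist_comm]
          exact hzy.le
        _ = c / 2 := by rw [hδ]; field_simp
    have hxz : ⟪x - z, v⟫ ≤ -(c / 2) := by
      have : x - z = (y - z) - (y - x) := by abel
      rw [real_inner_comm, this, inner_sub_right]
      linarith
    have hsq : dist (x + t • v) z ^ 2 = dist x z ^ 2 + 2 * (t * ⟪x - z, v⟫) + t ^ 2 * ‖v‖ ^ 2 := by
      rw [dist_eq_norm, dist_eq_norm, show x + t • v - z = (x - z) + t • v by abel,
        norm_add_sq_real, inner_smul_right, norm_smul, mul_pow, Real.norm_of_nonneg ht0.le]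
    have h1 : dist x z ^ 2 ≤ dist x y ^ 2 := by
      gcongr
      exact hfar z hz
    have h2 : t * ⟪x - z, v⟫ ≤ t * -(c / 2) := by gcongr
    have h3 : t ^ 2 * ‖v‖ ^ 2 ≤ t ^ 2 * M ^ 2 := by gcongr
    have h4 : t * (t * (2 * M ^ 2)) ≤ t * c := by gcongr
    have h5 := mul_pos ht0 hc
    refine lt_of_pow_lt_pow_left₀ 2 dist_nonneg ?_
    rw [hsq]
    linarith

end

theorem stmt8 (V : Set (EuclideanSpace ℝ (Fin 3))) (hV : V.Finite)
    (K : Set (EuclideanSpace ℝ (Fin 3))) (hK : K = convexHull ℝ V)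
    (hint : (interior K).Nonempty)
    (P : Set (EuclideanSpace ℝ (Fin 3))) (hP : P = frontier K)
    (x y : EuclideanSpace ℝ (Fin 3)) (hx : x ∈ P) (hy : y ∈ P)
    (hfar : ∀ z ∈ P, dist x z ≤ dist x y)
    (huniq : ∀ z ∈ P, dist x z = dist x y → z = y)
    (hrad : edist x y = extrinsicRad P) :
    ∀ z ∈ K, 0 ≤ ⟪z - x, y - x⟫ := by
  intro z hz
  by_contra! hneg
  have hKc : Convex ℝ K := hK ▸ convex_convexHull ℝ V
  have hKcomp : IsCompact K := hK ▸ hV.isCompact_convexHull ℝ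
  have hPK : P ⊆ K := hP ▸ hKcomp.isClosed.frontier_subset
  have hPcomp : IsCompact P := hKcomp.of_isClosed_subset (hP ▸ isClosed_frontier) hPK
  set u := y - x with hu
  have hu0 : u ≠ 0 := by
    intro h
    simp [h] at hneg
  obtain ⟨a, ha⟩ := exists_inner_sub_nonpos_of_mem_frontier hKc hint (hP ▸ hx)
  have ha0 : a ≠ 0 := by
    rintro rfl
    obtain ⟨k, hk⟩ := hint
    simpa using (ha k (interior_subset hk)).2 hk
  obtain ⟨w, haw, huw⟩ := exists_inner_pos_of_inner_nonpos_of_inner_neg ha0 hu0 (ha z hz).1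
    (real_inner_comm u (z - x) ▸ hneg)
  have huu : 0 < ⟪u, u⟫ := real_inner_self_pos.2 hu0
  obtain ⟨t, ht0, ht1, hclose⟩ := exists_pos_forall_dist_add_smul_lt hPcomp hfar huniq
    (lt_min huu huw) (lt_max_of_lt_left (norm_pos_iff.2 hu0) : 0 < max ‖u‖ ‖w‖)
  have hconn : IsPreconnected ((fun v => x + t • v) '' segment ℝ u w) :=
    (convex_segment u w).isPreconnected.image _ (by fun_prop)
  obtain ⟨_, ⟨v, hv, rfl⟩, hvK⟩ := exists_mem_frontier_of_isPreconnected hconn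
    ⟨u, left_mem_segment ℝ u w, rfl⟩
    (hKc.add_smul_sub_mem (hPK hx) (hPK hy) ⟨ht0.le, ht1⟩)
    ⟨w, right_mem_segment ℝ u w, rfl⟩ (fun hmem => by
      have := (ha _ hmem).1
      rw [add_sub_cancel_left, inner_smul_right] at this
      exact this.not_gt (mul_pos ht0 haw))
  have hvM : ‖v‖ ≤ max ‖u‖ ‖w‖ :=
    (convexOn_norm convex_univ).le_on_segment trivial trivial hv
  have hvc : min ⟪u, u⟫ ⟪u, w⟫ ≤ ⟪v, u⟫ := by
    rw [real_inner_comm u v]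
    obtain ⟨p, q, hp, hq, hpq, rfl⟩ := hv
    rw [inner_add_right, inner_smul_right, inner_smul_right]
    exact Convex.min_le_combo _ _ hp hq hpq
  obtain ⟨s, hs, hle⟩ := exists_extrinsicRad_le_edist hPcomp (hP ▸ hvK : x + t • v ∈ P)
  rw [← hrad, edist_dist, edist_dist, ENNReal.ofReal_le_ofReal_iff dist_nonneg] at hle
  exact (hclose v hvM hvc s hs).not_ge hle
end

section
/- For an isosceles tetrahedron, the total angle at each vertex is π: ∠ b a c + ∠ c a d + ∠ d a b = π, ∠ a b c + ∠ c b d + ∠ d b a = π, ∠ a c b + ∠ b c d + ∠ d c a = π, and ∠ a d b + ∠ b d c + ∠ c d a = π. -/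
open EuclideanGeometry Real

/-- The angles at `p` of the three triangles `q p r`, `r p s`, `s p q` are the angles of the
triangle `q r s` when opposite edges are pairwise equal. -/
theorem angle_add_angle_add_angle_eq_pi_of_dist_eq_opposite {V P : Type*}
    [NormedAddCommGroup V] [InnerProductSpace ℝ V] [MetricSpace P] [NormedAddTorsor V P]
    {p q r s : P} (hqr : q ≠ r)
    (h₁ : dist p q = dist r s) (h₂ : dist p r = dist q s) (h₃ : dist p s = dist q r) :
    ∠ q p r + ∠ r p s + ∠ s p q = π := by
  have hs : ∠ q p r = ∠ r s q :=
    angle_eq_of_congruent (v₁ := ![q, p, r]) (v₂ := ![r, s, q])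
      (side_side_side (by rw [dist_comm, h₁]) (by rw [h₂, dist_comm]) (dist_comm r q)) 0 1 2
  have hq : ∠ r p s = ∠ s q r :=
    angle_eq_of_congruent (v₁ := ![r, p, s]) (v₂ := ![s, q, r])
      (side_side_side (by rw [dist_comm, h₂, dist_comm]) h₃ (dist_comm s r)) 0 1 2
  have hr : ∠ s p q = ∠ q r s :=
    angle_eq_of_congruent (v₁ := ![s, p, q]) (v₂ := ![q, r, s])
      (side_side_side (by rw [dist_comm, h₃]) h₁ (dist_comm q s)) 0 1 2
  linarith [angle_add_angle_add_angle_eq_pi s hqr.symm]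

theorem stmt9 (a b c d : EuclideanSpace ℝ (Fin 3))
    (hind : AffineIndependent ℝ ![a, b, c, d])
    (h1 : dist a b = dist c d) (h2 : dist a c = dist b d) (h3 : dist a d = dist b c) :
    ∠ b a c + ∠ c a d + ∠ d a b = π ∧
    ∠ a b c + ∠ c b d + ∠ d b a = π ∧
    ∠ a c b + ∠ b c d + ∠ d c a = π ∧
    ∠ a d b + ∠ b d c + ∠ c d a = π := by
  have hab : a ≠ b := hind.injective.ne (show (0 : Fin 4) ≠ 1 by decide)
  have hac : a ≠ c := hind.injective.ne (show (0 : Fin 4) ≠ 2 by decide)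
  have hbc : b ≠ c := hind.injective.ne (show (1 : Fin 4) ≠ 2 by decide)
  refine ⟨?_, ?_, ?_, ?_⟩
  · exact angle_add_angle_add_angle_eq_pi_of_dist_eq_opposite hbc h1 h2 h3
  · exact angle_add_angle_add_angle_eq_pi_of_dist_eq_opposite hac
      (by rw [dist_comm, h1]) h3.symm h2.symm
  · exact angle_add_angle_add_angle_eq_pi_of_dist_eq_opposite hab
      (by rw [dist_comm, h2]) (by rw [dist_comm, h3]) h1.symm
  · exact angle_add_angle_add_angle_eq_pi_of_dist_eq_opposite hab
      (by rw [dist_comm, h3]) (by rw [dist_comm, h2]) (by rw [dist_comm, h1])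
end
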